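/- arXiv:1904.01436 — 4 statements merged into one kernel-verified Lean document; each statement's English description precedes it below -/
import Mathlib

section
/- For every n ≥ 3, the level B_3(n) of the weak Bruhat lattice is EKR: every intersecting family P ⊆ B_3(n) satisfies |P| ≤ C(n−1, 2), and this maximum is attained by the star {q ∈ B_3(n) : p ≼ q} for a rank-1 permutation p. -/
/-- The inversion set of a permutation `p` of `{0,…,n-1}` (0-indexed version of
`Inv(p) = {(p_j, p_i) : i < j, p_j < p_i}`): pairs `(a, b)` of values with `a < b`
such that `b` precedes `a` in the one-line notation of `p`. -/
def InvSet (n : ℕ) (p : Equiv.Perm (Fin n)) : Finset (Fin n × Fin n) :=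
  Finset.univ.filter (fun x => x.1 < x.2 ∧ p.symm x.2 < p.symm x.1)

/-- The weak (right) Bruhat order: `p ≼ q` iff `Inv(p) ⊆ Inv(q)`. -/
def BLE {n : ℕ} (p q : Equiv.Perm (Fin n)) : Prop :=
  InvSet n p ⊆ InvSet n q

/-- The rank of a permutation in the weak Bruhat order: `rank(p) = |Inv(p)|`. -/
def brank (n : ℕ) (p : Equiv.Perm (Fin n)) : ℕ :=
  (InvSet n p).card

/-- The inverse descent set `ID(p) ⊆ {1,…,n-1}`: `i ∈ ID(p)` iff the (1-indexed)
value `i+1` precedes the value `i` in the one-line notation of `p`.  Here the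
1-indexed value `v ∈ {1,…,n}` corresponds to the element of `Fin n` with `val = v - 1`. -/
def ID (n : ℕ) (p : Equiv.Perm (Fin n)) : Finset ℕ :=
  (Finset.Icc 1 (n - 1)).filter
    (fun i => ∃ a b : Fin n, (a : ℕ) + 1 = i ∧ (b : ℕ) = i ∧ p.symm b < p.symm a)

/-- The generator `g i` is the adjacent transposition interchanging the
(1-indexed) values `i` and `i+1`. -/
def g (n i : ℕ) : Equiv.Perm (Fin n) :=
  if h : 1 ≤ i ∧ i < n then Equiv.swap ⟨i - 1, by omega⟩ ⟨i, h.2⟩ else 1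

/-- A family of permutations is intersecting if any two of its members have
meet different from the identity in the weak Bruhat lattice; equivalently (since the
identity is the minimum), any two members have a common lower bound distinct
from the identity. -/
def BInter (n : ℕ) (P : Set (Equiv.Perm (Fin n))) : Prop :=
  ∀ p ∈ P, ∀ q ∈ P, ∃ r : Equiv.Perm (Fin n), r ≠ 1 ∧ BLE r p ∧ BLE r q

/-- A maximal intersecting family: intersecting, and every permutation
intersecting all its members belongs to it. -/
def MaxBInter (n : ℕ) (P : Set (Equiv.Perm (Fin n))) : Prop :=
  BInter n P ∧ ∀ q : Equiv.Perm (Fin n),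
    (∀ p ∈ P, ∃ r : Equiv.Perm (Fin n), r ≠ 1 ∧ BLE r q ∧ BLE r p) → q ∈ P

/-- The set of `≼`-minimal elements of a family `P`. -/
def minSet (n : ℕ) (P : Set (Equiv.Perm (Fin n))) : Set (Equiv.Perm (Fin n)) :=
  {p | p ∈ P ∧ ∀ q ∈ P, BLE q p → q = p}

/-- `m` is the meet (greatest lower bound) of `p` and `q` in the weak Bruhat order. -/
def IsMeetB (n : ℕ) (p q m : Equiv.Perm (Fin n)) : Prop :=
  BLE m p ∧ BLE m q ∧ ∀ r, BLE r p → BLE r q → BLE r m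

/-- `m` is the join (least upper bound) of the set `S` in the weak Bruhat order. -/
def IsLUBB (n : ℕ) (S : Set (Equiv.Perm (Fin n))) (m : Equiv.Perm (Fin n)) : Prop :=
  (∀ s ∈ S, BLE s m) ∧ ∀ u, (∀ s ∈ S, BLE s u) → BLE m u

/-- For a system `𝒜` of subsets of `{1,…,n-1}`,
`P(𝒜) = {p : A ⊆ ID(p) for some A ∈ 𝒜}`. -/
def PofSystem (n : ℕ) (𝒜 : Set (Finset ℕ)) : Set (Equiv.Perm (Fin n)) :=
  {p | ∃ A ∈ 𝒜, A ⊆ ID n p}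

/-- The generating set system of a family `P`: `{ID(p) : p ∈ min(P)}`. -/
def genSys (n : ℕ) (P : Set (Equiv.Perm (Fin n))) : Set (Finset ℕ) :=
  {A | ∃ p ∈ minSet n P, ID n p = A}

/-- A maximal intersecting antichain of subsets of `{1,…,n-1}`: an antichain
under inclusion, any two members of which meet, such that for every subset `B`
of `{1,…,n-1}` not in the system there is a member `A` with `A ∩ B = ∅` or `A ⊆ B`. -/
def MIA (n : ℕ) (𝒜 : Set (Finset ℕ)) : Prop :=
  (∀ A ∈ 𝒜, ∀ B ∈ 𝒜, A ⊆ B → A = B) ∧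
  (∀ A ∈ 𝒜, ∀ B ∈ 𝒜, (A ∩ B).Nonempty) ∧
  (∀ B : Finset ℕ, B ⊆ Finset.Icc 1 (n - 1) → B ∉ 𝒜 → ∃ A ∈ 𝒜, A ∩ B = ∅ ∨ A ⊆ B)

/-- The adjacent transposition interchanging the values `i` and `i + 1`. -/
def adjSwap {m : ℕ} (i : Fin m) : Equiv.Perm (Fin (m + 1)) :=
  Equiv.swap i.castSucc i.succ

/-- The values `i` such that `i + 1` precedes `i` in the one-line notation of `q`. -/
def invDescents {m : ℕ} (q : Equiv.Perm (Fin (m + 1))) : Finset (Fin m) :=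
  Finset.univ.filter fun i => q.symm i.succ < q.symm i.castSucc

/-- The permutations of rank `r`. -/
def rankLevel (m r : ℕ) : Finset (Equiv.Perm (Fin (m + 1))) :=
  Finset.univ.filter fun q => brank (m + 1) q = r

section Descents

variable {m : ℕ} {i j : Fin m} {p q : Equiv.Perm (Fin (m + 1))}

lemma mem_invDescents : i ∈ invDescents q ↔ q.symm i.succ < q.symm i.castSucc := by
  simp [invDescents]

lemma mem_invSet {n : ℕ} {q : Equiv.Perm (Fin n)} {x : Fin n × Fin n} :
    x ∈ InvSet n q ↔ x.1 < x.2 ∧ q.symm x.2 < q.symm x.1 := by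
  simp [InvSet]

lemma mem_rankLevel {r : ℕ} : q ∈ rankLevel m r ↔ brank (m + 1) q = r := by
  simp [rankLevel]

lemma mem_invDescents_iff_mem_invSet :
    i ∈ invDescents q ↔ (i.castSucc, i.succ) ∈ InvSet (m + 1) q := by
  simp [mem_invDescents, mem_invSet]

lemma adjSwap_mul_self (i : Fin m) : adjSwap i * adjSwap i = 1 :=
  Equiv.swap_mul_self _ _

lemma adjSwap_mul_cancel (i : Fin m) (q : Equiv.Perm (Fin (m + 1))) :
    adjSwap i * (adjSwap i * q) = q := by
  rw [← mul_assoc, adjSwap_mul_self, one_mul]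

lemma adjSwap_apply_self (i : Fin m) (a : Fin (m + 1)) : adjSwap i (adjSwap i a) = a :=
  Equiv.swap_apply_self _ _ _

lemma adjSwap_mul_symm_apply (i : Fin m) (q : Equiv.Perm (Fin (m + 1))) (x : Fin (m + 1)) :
    (adjSwap i * q).symm x = q.symm (adjSwap i x) := by
  simp [adjSwap, Equiv.Perm.mul_def]

lemma adjSwap_lt {a b : Fin (m + 1)} (hab : a < b) (h : (a, b) ≠ (i.castSucc, i.succ)) :
    adjSwap i a < adjSwap i b := by
  obtain ⟨a, ha⟩ := a
  obtain ⟨b, hb⟩ := b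
  obtain ⟨i, hi⟩ := i
  simp only [ne_eq, Prod.mk.injEq, Fin.castSucc_mk, Fin.succ_mk, Fin.mk.injEq, Fin.mk_lt_mk] at h hab
  simp only [adjSwap, Equiv.swap_apply_def, Fin.castSucc_mk, Fin.succ_mk, Fin.mk.injEq]
  split_ifs <;> simp only [Fin.mk_lt_mk] <;> omega

lemma mem_invDescents_adjSwap_mul_self :
    i ∈ invDescents (adjSwap i * q) ↔ i ∉ invDescents q := by
  have h : q.symm i.castSucc ≠ q.symm i.succ := by simp [Fin.ext_iff]
  simp only [mem_invDescents, adjSwap_mul_symm_apply]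
  simp only [adjSwap, Equiv.swap_apply_left, Equiv.swap_apply_right, not_lt]
  exact ⟨le_of_lt, fun h' => lt_of_le_of_ne h' h⟩

lemma mem_invDescents_adjSwap_mul_of_far (h : (i : ℕ) + 1 < j ∨ (j : ℕ) + 1 < i) :
    j ∈ invDescents (adjSwap i * q) ↔ j ∈ invDescents q := by
  simp only [mem_invDescents, adjSwap_mul_symm_apply]
  rw [adjSwap, Equiv.swap_apply_of_ne_of_ne, Equiv.swap_apply_of_ne_of_ne] <;>
    simp only [ne_eq, Fin.ext_iff, Fin.val_castSucc, Fin.val_succ] <;> omega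

lemma brank_adjSwap_mul (h : i ∈ invDescents q) :
    brank (m + 1) (adjSwap i * q) + 1 = brank (m + 1) q := by
  have hmem := mem_invDescents_iff_mem_invSet.1 h
  have hnot : (i.castSucc, i.succ) ∉ InvSet (m + 1) (adjSwap i * q) := by
    rw [← mem_invDescents_iff_mem_invSet, mem_invDescents_adjSwap_mul_self, not_not]
    exact h
  have hne : ∀ {a b : Fin (m + 1)}, a < b →
      (adjSwap i a, adjSwap i b) ≠ (i.castSucc, i.succ) := by
    intro a b hab he
    rw [Prod.mk.injEq] at he
    have ha := congrArg (adjSwap i) he.1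
    have hb := congrArg (adjSwap i) he.2
    rw [adjSwap_apply_self] at ha hb
    simp only [adjSwap, Equiv.swap_apply_left, Equiv.swap_apply_right] at ha hb
    subst ha hb
    exact absurd hab (by simp [Fin.lt_def])
  unfold brank
  rw [← Finset.card_erase_add_one hmem, Nat.add_right_cancel_iff]
  refine Finset.card_nbij' (fun x => (adjSwap i x.1, adjSwap i x.2))
    (fun x => (adjSwap i x.1, adjSwap i x.2)) ?_ ?_ ?_ ?_
  · rintro ⟨a, b⟩ hx
    have hx' := mem_invSet.1 hx
    rw [adjSwap_mul_symm_apply, adjSwap_mul_symm_apply] at hx'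
    have hab : (a, b) ≠ (i.castSucc, i.succ) := fun h' => hnot (h' ▸ hx)
    exact Finset.mem_coe.2 (Finset.mem_erase.2
      ⟨hne hx'.1, mem_invSet.2 ⟨adjSwap_lt hx'.1 hab, hx'.2⟩⟩)
  · rintro ⟨a, b⟩ hx
    obtain ⟨hab, hx'⟩ := Finset.mem_erase.1 (Finset.mem_coe.1 hx)
    rw [mem_invSet] at hx'
    refine Finset.mem_coe.2 (mem_invSet.2 ⟨adjSwap_lt hx'.1 hab, ?_⟩)
    simp only [adjSwap_mul_symm_apply, adjSwap_apply_self]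
    exact hx'.2
  · rintro ⟨a, b⟩ -
    simp [adjSwap_apply_self]
  · rintro ⟨a, b⟩ -
    simp [adjSwap_apply_self]

lemma brank_adjSwap_mul_of_notMem (h : i ∉ invDescents q) :
    brank (m + 1) (adjSwap i * q) = brank (m + 1) q + 1 := by
  rw [← mem_invDescents_adjSwap_mul_self] at h
  rw [← brank_adjSwap_mul h, adjSwap_mul_cancel]

lemma eq_one_of_invDescents_eq_empty (h : invDescents q = ∅) : q = 1 := by
  have hmono : StrictMono q.symm := by
    refine Fin.strictMono_iff_lt_succ.2 fun i => ?_
    have hi : i ∉ invDescents q := by simp [h]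
    rw [mem_invDescents, not_lt] at hi
    exact lt_of_le_of_ne hi (by simp [Fin.ext_iff])
  have hid : (q.symm : Fin (m + 1) → Fin (m + 1)) = id :=
    (hmono.range_inj strictMono_id).1 (by simp)
  have : q.symm = 1 := Equiv.ext fun x => congrFun hid x
  rw [← q.symm_symm, this]
  rfl

lemma invDescents_nonempty (h : q ≠ 1) : (invDescents q).Nonempty :=
  Finset.nonempty_iff_ne_empty.2 fun h' => h (eq_one_of_invDescents_eq_empty h')

lemma invDescents_one : invDescents (1 : Equiv.Perm (Fin (m + 1))) = ∅ := by
  ext i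
  simp [mem_invDescents, Equiv.Perm.one_def, Fin.lt_def]

lemma brank_one : brank (m + 1) 1 = 0 := by
  rw [brank, Finset.card_eq_zero, Finset.eq_empty_iff_forall_notMem]
  intro x hx
  rw [mem_invSet] at hx
  exact lt_asymm hx.1 hx.2

lemma eq_one_of_brank_eq_zero (h : brank (m + 1) q = 0) : q = 1 := by
  by_contra hq
  obtain ⟨i, hi⟩ := invDescents_nonempty hq
  have := brank_adjSwap_mul hi
  omega

lemma brank_adjSwap (i : Fin m) : brank (m + 1) (adjSwap i) = 1 := by
  have := brank_adjSwap_mul_of_notMem (i := i) (q := 1) (by simp [invDescents_one])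
  rwa [mul_one, brank_one] at this

lemma mem_invDescents_adjSwap (i : Fin m) : i ∈ invDescents (adjSwap i) := by
  rw [← mul_one (adjSwap i), mem_invDescents_adjSwap_mul_self, invDescents_one]
  simp

lemma eq_adjSwap_of_brank_eq_one (h : brank (m + 1) q = 1) (hi : i ∈ invDescents q) :
    q = adjSwap i := by
  have h1 := brank_adjSwap_mul hi
  have h2 : adjSwap i * q = 1 := eq_one_of_brank_eq_zero (by omega)
  rw [← adjSwap_mul_cancel i q, h2, mul_one]

lemma ne_one_of_brank_pos (h : 0 < brank (m + 1) q) : q ≠ 1 := by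
  rintro rfl
  rw [brank_one] at h
  exact h.false

lemma exists_eq_adjSwap_of_brank_eq_one (h : brank (m + 1) q = 1) : ∃ i, q = adjSwap i :=
  let ⟨i, hi⟩ := invDescents_nonempty (ne_one_of_brank_pos (by omega))
  ⟨i, eq_adjSwap_of_brank_eq_one h hi⟩

lemma adjSwap_injective : Function.Injective (adjSwap (m := m)) := by
  intro i j hij
  have h := congrArg (fun p => p i.castSucc) hij
  have h' := congrArg (fun p => p j.castSucc) hij
  obtain ⟨i, hi⟩ := i
  obtain ⟨j, hj⟩ := j
  simp only [adjSwap, Equiv.swap_apply_def, Fin.castSucc_mk, Fin.succ_mk, Fin.mk.injEq] at h h' ⊢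
  split_ifs at h h' <;> simp only [Fin.mk.injEq] at h h' <;> omega

lemma mem_invDescents_adjSwap_iff : j ∈ invDescents (adjSwap i) ↔ j = i := by
  refine ⟨fun h => ?_, fun h => h ▸ mem_invDescents_adjSwap i⟩
  exact (adjSwap_injective (eq_adjSwap_of_brank_eq_one (brank_adjSwap i) h)).symm

lemma card_invDescents_le (q : Equiv.Perm (Fin (m + 1))) :
    (invDescents q).card ≤ brank (m + 1) q := by
  refine Finset.card_le_card_of_injOn (fun i => (i.castSucc, i.succ))
    (fun i hi => mem_invDescents_iff_mem_invSet.1 hi) ?_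
  intro i _ j _ h
  simpa using congrArg Prod.fst h

lemma invDescents_subset_of_BLE (h : BLE p q) : invDescents p ⊆ invDescents q := by
  intro i hi
  rw [mem_invDescents_iff_mem_invSet] at hi ⊢
  exact h hi

lemma BLE_adjSwap_iff : BLE (adjSwap i) q ↔ i ∈ invDescents q := by
  refine ⟨fun h => invDescents_subset_of_BLE h (mem_invDescents_adjSwap i), fun h => ?_⟩
  have hcard : (InvSet (m + 1) (adjSwap i)).card = 1 := brank_adjSwap i
  obtain ⟨x, hx⟩ := Finset.card_eq_one.1 hcard
  have hi := mem_invDescents_iff_mem_invSet.1 (mem_invDescents_adjSwap i)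
  rw [hx, Finset.mem_singleton] at hi
  rw [BLE, hx, Finset.singleton_subset_iff, ← hi]
  exact mem_invDescents_iff_mem_invSet.1 h

lemma eq_braid_of_mem_invDescents (hq : brank (m + 1) q = 3) (hi : i ∈ invDescents q)
    (hj : j ∈ invDescents q) (hij : (i : ℕ) + 1 = j) :
    q = adjSwap i * (adjSwap j * adjSwap i) := by
  have hs : j.castSucc = i.succ := Fin.ext (by simp [← hij])
  have hlt : q.symm j.succ < q.symm i.castSucc := by
    rw [mem_invDescents] at hi hj
    rw [hs] at hj
    exact hj.trans hi
  have e1 : adjSwap i j.succ = j.succ := by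
    refine Equiv.swap_apply_of_ne_of_ne ?_ ?_ <;>
      simp only [ne_eq, Fin.ext_iff, Fin.val_castSucc, Fin.val_succ] <;> omega
  have e2 : adjSwap j i.castSucc = i.castSucc := by
    refine Equiv.swap_apply_of_ne_of_ne ?_ ?_ <;>
      simp only [ne_eq, Fin.ext_iff, Fin.val_castSucc, Fin.val_succ] <;> omega
  have e3 : adjSwap i j.castSucc = i.castSucc := by
    rw [hs]
    exact Equiv.swap_apply_right _ _
  have e4 : adjSwap j i.succ = j.succ := by
    rw [← hs]
    exact Equiv.swap_apply_left _ _
  have e5 : adjSwap i i.castSucc = j.castSucc := by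
    rw [hs]
    exact Equiv.swap_apply_left _ _
  have h1 := brank_adjSwap_mul hi
  have hj' : j ∈ invDescents (adjSwap i * q) := by
    rw [mem_invDescents, adjSwap_mul_symm_apply, adjSwap_mul_symm_apply, e1, e3]
    exact hlt
  have h2 := brank_adjSwap_mul hj'
  have hi' : i ∈ invDescents (adjSwap j * (adjSwap i * q)) := by
    simp only [mem_invDescents, adjSwap_mul_symm_apply, e2, e4, e1, e5]
    exact mem_invDescents.1 hj
  have h3 := eq_adjSwap_of_brank_eq_one (by omega) hi'
  calc q = adjSwap i * (adjSwap j * (adjSwap j * (adjSwap i * q))) := by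
        rw [adjSwap_mul_cancel, adjSwap_mul_cancel]
    _ = _ := by rw [h3]

lemma eq_of_far_mem_invDescents (hq : brank (m + 1) q = 3) (hi : i ∈ invDescents q)
    (hj : j ∈ invDescents q) (hij : (i : ℕ) + 1 < j ∨ (j : ℕ) + 1 < i) :
    ∃ k, k ≠ i ∧ k ≠ j ∧ q = adjSwap i * (adjSwap j * adjSwap k) := by
  have h1 := brank_adjSwap_mul hi
  have hj' : j ∈ invDescents (adjSwap i * q) := (mem_invDescents_adjSwap_mul_of_far hij).2 hj
  have h2 := brank_adjSwap_mul hj'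
  obtain ⟨k, hk⟩ := exists_eq_adjSwap_of_brank_eq_one
    (q := adjSwap j * (adjSwap i * q)) (by omega)
  have hkm : k ∈ invDescents (adjSwap j * (adjSwap i * q)) := hk ▸ mem_invDescents_adjSwap k
  refine ⟨k, ?_, ?_, ?_⟩
  · rintro rfl
    rw [mem_invDescents_adjSwap_mul_of_far hij.symm, mem_invDescents_adjSwap_mul_self] at hkm
    exact hkm hi
  · rintro rfl
    rw [mem_invDescents_adjSwap_mul_self] at hkm
    exact hkm hj'
  · rw [← hk, adjSwap_mul_cancel, adjSwap_mul_cancel]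

end Descents

section Counting

variable {m : ℕ} {i j k : Fin m} {p q : Equiv.Perm (Fin (m + 1))}

lemma card_invDescents_lt (hi : i ∈ invDescents q) (hj : j ∈ invDescents q)
    (hij : (i : ℕ) + 1 = j) : (invDescents q).card < brank (m + 1) q := by
  have hs : j.castSucc = i.succ := Fin.ext (by simp [← hij])
  have hinj : Function.Injective fun c : Fin m => (c.castSucc, c.succ) := by
    intro c d h
    simpa using congrArg Prod.fst h
  rw [← Finset.card_image_of_injective _ hinj]
  refine Finset.card_lt_card (Finset.ssubset_iff_of_subset ?_ |>.2 ⟨(i.castSucc, j.succ), ?_, ?_⟩)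
  · intro x hx
    obtain ⟨c, hc, rfl⟩ := Finset.mem_image.1 hx
    exact mem_invDescents_iff_mem_invSet.1 hc
  · rw [mem_invDescents] at hi hj
    rw [hs] at hj
    refine mem_invSet.2 ⟨?_, hj.trans hi⟩
    simp only [Fin.lt_def, Fin.val_castSucc, Fin.val_succ]
    omega
  · intro hx
    obtain ⟨c, -, hc⟩ := Finset.mem_image.1 hx
    simp only [Prod.mk.injEq, Fin.ext_iff, Fin.val_castSucc, Fin.val_succ] at hc
    omega

lemma far_of_card_invDescents_eq_brank (h : (invDescents q).card = brank (m + 1) q)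
    (hi : i ∈ invDescents q) (hj : j ∈ invDescents q) (hij : i ≠ j) :
    (i : ℕ) + 1 < j ∨ (j : ℕ) + 1 < i := by
  have h1 : (i : ℕ) + 1 ≠ j := fun h' => (card_invDescents_lt hi hj h').ne h
  have h2 : (j : ℕ) + 1 ≠ i := fun h' => (card_invDescents_lt hj hi h').ne h
  rw [ne_eq, Fin.ext_iff] at hij
  omega

lemma eq_of_invDescents_eq (hp : brank (m + 1) p = 3) (hq : brank (m + 1) q = 3)
    (hc : (invDescents q).card = 3) (h : invDescents p = invDescents q) : p = q := by
  obtain ⟨i, j, k, hij, hik, hjk, hd⟩ := Finset.card_eq_three.1 hc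
  have key : ∀ r : Equiv.Perm (Fin (m + 1)), brank (m + 1) r = 3 → invDescents r = {i, j, k} →
      r = adjSwap i * (adjSwap j * adjSwap k) := by
    intro r hr hd
    have hi : i ∈ invDescents r := by simp [hd]
    have hj : j ∈ invDescents r := by simp [hd]
    have hk : k ∈ invDescents r := by simp [hd]
    have hcard : (invDescents r).card = brank (m + 1) r := by
      rw [hr, hd]
      exact Finset.card_eq_three.2 ⟨i, j, k, hij, hik, hjk, rfl⟩
    have fij := far_of_card_invDescents_eq_brank hcard hi hj hij
    have fik := far_of_card_invDescents_eq_brank hcard hi hk hik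
    have fjk := far_of_card_invDescents_eq_brank hcard hj hk hjk
    have hj' := (mem_invDescents_adjSwap_mul_of_far (q := r) fij).2 hj
    have hk' := (mem_invDescents_adjSwap_mul_of_far (q := adjSwap i * r) fjk).2
      ((mem_invDescents_adjSwap_mul_of_far fik).2 hk)
    have h1 := brank_adjSwap_mul hi
    have h2 := brank_adjSwap_mul hj'
    rw [← eq_adjSwap_of_brank_eq_one (by omega) hk', adjSwap_mul_cancel, adjSwap_mul_cancel]
  rw [key p hp (h.trans hd), key q hq hd]

lemma card_filter_mem_rankLevel_succ (i : Fin m) (r : ℕ) :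
    ((rankLevel m (r + 1)).filter fun q => i ∈ invDescents q).card =
      ((rankLevel m r).filter fun q => i ∉ invDescents q).card := by
  refine Finset.card_nbij' (fun q => adjSwap i * q) (fun q => adjSwap i * q) ?_ ?_ ?_ ?_
  · intro q hq
    obtain ⟨hr, hi⟩ := Finset.mem_filter.1 (Finset.mem_coe.1 hq)
    have := brank_adjSwap_mul hi
    rw [mem_rankLevel] at hr
    exact Finset.mem_coe.2 (Finset.mem_filter.2 ⟨mem_rankLevel.2 (by dsimp only; omega),
      by rw [mem_invDescents_adjSwap_mul_self, not_not]; exact hi⟩)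
  · intro q hq
    obtain ⟨hr, hi⟩ := Finset.mem_filter.1 (Finset.mem_coe.1 hq)
    have := brank_adjSwap_mul_of_notMem hi
    rw [mem_rankLevel] at hr
    exact Finset.mem_coe.2 (Finset.mem_filter.2 ⟨mem_rankLevel.2 (by dsimp only; omega),
      mem_invDescents_adjSwap_mul_self.2 hi⟩)
  · intro q _
    exact adjSwap_mul_cancel i q
  · intro q _
    exact adjSwap_mul_cancel i q

lemma card_filter_mem_rankLevel_add (i : Fin m) (r : ℕ) :
    ((rankLevel m (r + 1)).filter fun q => i ∈ invDescents q).card +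
      ((rankLevel m r).filter fun q => i ∈ invDescents q).card = (rankLevel m r).card := by
  rw [card_filter_mem_rankLevel_succ, add_comm, Finset.card_filter_add_card_filter_not]

lemma card_rankLevel_zero (m : ℕ) : (rankLevel m 0).card = 1 := by
  refine Finset.card_eq_one.2 ⟨1, ?_⟩
  ext q
  rw [mem_rankLevel, Finset.mem_singleton]
  exact ⟨eq_one_of_brank_eq_zero, fun h => h ▸ brank_one⟩

lemma card_rankLevel_one (m : ℕ) : (rankLevel m 1).card = m := by
  have : rankLevel m 1 = Finset.univ.image adjSwap := by
    ext q
    simp only [mem_rankLevel, Finset.mem_image, Finset.mem_univ, true_and]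
    refine ⟨fun h => ?_, ?_⟩
    · obtain ⟨i, hi⟩ := exists_eq_adjSwap_of_brank_eq_one h
      exact ⟨i, hi.symm⟩
    · rintro ⟨i, rfl⟩
      exact brank_adjSwap i
  rw [this, Finset.card_image_of_injective _ adjSwap_injective, Finset.card_univ, Fintype.card_fin]

lemma card_filter_lt_or_eq_succ (m : ℕ) :
    (Finset.univ.filter fun x : Fin m × Fin m =>
      x.1 < x.2 ∨ (x.1 : ℕ) = x.2 + 1).card = m.choose 2 + (m - 1) := by
  rw [Finset.filter_or, Finset.card_union_of_disjoint]
  · congr 1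
    · rw [Finset.card_filter, Fintype.sum_prod_type_right]
      have : ∀ b : Fin m, (∑ a : Fin m, if a < b then 1 else 0) = (b : ℕ) := by
        intro b
        rw [← Finset.card_filter, ← Fin.card_Iio b]
        congr 1
        ext a
        simp
      simp only [this]
      rw [Fin.sum_univ_eq_sum_range (fun a => a), Finset.sum_range_id, Nat.choose_two_right]
    · obtain _ | l := m
      · rfl
      · have : (Finset.univ.filter fun x : Fin (l + 1) × Fin (l + 1) => (x.1 : ℕ) = x.2 + 1) =
            Finset.univ.image fun a : Fin l => (a.succ, a.castSucc) := by
          ext ⟨a, b⟩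
          simp only [Finset.mem_filter, Finset.mem_univ, true_and, Finset.mem_image,
            Prod.mk.injEq, Fin.ext_iff, Fin.val_succ, Fin.val_castSucc]
          refine ⟨fun h => ⟨⟨b, by omega⟩, h.symm, rfl⟩, ?_⟩
          rintro ⟨c, h1, h2⟩
          omega
        rw [this, Finset.card_image_of_injective, Finset.card_univ, Fintype.card_fin]
        · rfl
        · intro a b h
          simpa using congrArg Prod.snd h
  · rw [Finset.disjoint_filter]
    intro x _ h
    rw [Fin.lt_def] at h
    omega

lemma card_rankLevel_two (m : ℕ) : (rankLevel m 2).card = m.choose 2 + (m - 1) := by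
  rw [← card_filter_lt_or_eq_succ]
  have hstep : ∀ {q : Equiv.Perm (Fin (m + 1))}, brank (m + 1) q = 2 → ∀ {i j : Fin m},
      i ∈ invDescents q → j ∈ invDescents q → i ≠ j →
      ((i : ℕ) + 1 < j ∨ (j : ℕ) + 1 < i) ∧ q = adjSwap i * adjSwap j := by
    intro q hq i j hi hj hij
    have hcard : (invDescents q).card = brank (m + 1) q := by
      refine le_antisymm (card_invDescents_le q) ?_
      rw [hq, ← Finset.card_pair hij]
      exact Finset.card_le_card (by simp [Finset.insert_subset_iff, hi, hj])
    have hfar := far_of_card_invDescents_eq_brank hcard hi hj hij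
    have h1 := brank_adjSwap_mul hi
    have h2 := eq_adjSwap_of_brank_eq_one (by omega)
      ((mem_invDescents_adjSwap_mul_of_far hfar).2 hj)
    exact ⟨hfar, by rw [← h2, adjSwap_mul_cancel]⟩
  have hmem : ∀ {i j : Fin m}, i ≠ j → brank (m + 1) (adjSwap i * adjSwap j) = 2 ∧
      i ∈ invDescents (adjSwap i * adjSwap j) := by
    intro i j hij
    have hn : i ∉ invDescents (adjSwap j) := by rwa [mem_invDescents_adjSwap_iff]
    rw [brank_adjSwap_mul_of_notMem hn, brank_adjSwap, mem_invDescents_adjSwap_mul_self]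
    exact ⟨rfl, hn⟩
  have hcancel : ∀ {i j k : Fin m}, adjSwap i * adjSwap j = adjSwap i * adjSwap k → j = k :=
    fun h => adjSwap_injective (mul_left_cancel h)
  symm
  refine Finset.card_nbij (fun x => adjSwap x.1 * adjSwap x.2) ?_ ?_ ?_
  · rintro ⟨i, j⟩ hx
    rw [Finset.mem_coe, Finset.mem_filter, Fin.lt_def] at hx
    refine Finset.mem_coe.2 (mem_rankLevel.2 (hmem fun h => ?_).1)
    dsimp only at hx h
    subst h
    simp at hx
  · rintro ⟨i, j⟩ hx ⟨k, l⟩ hy (h : adjSwap i * adjSwap j = adjSwap k * adjSwap l)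
    simp only [Finset.coe_filter, Finset.mem_univ, true_and, Set.mem_ofPred_eq, Fin.lt_def] at hx hy
    have hij : i ≠ j := by
      rintro rfl
      simp at hx
    have hkl : k ≠ l := by
      rintro rfl
      simp at hy
    obtain ⟨hb, hi⟩ := hmem hij
    have hk := (hmem hkl).2
    rw [← h] at hk
    by_cases hik : i = k
    · subst hik
      rw [hcancel h]
    · obtain ⟨hfar, h1⟩ := hstep hb hi hk hik
      obtain ⟨-, h2⟩ := hstep hb hk hi (Ne.symm hik)
      have e1 := hcancel h1
      have e2 := hcancel (h.symm.trans h2)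
      subst e1 e2
      omega
  · intro q hq
    rw [Finset.mem_coe, mem_rankLevel] at hq
    obtain ⟨i, hi⟩ := invDescents_nonempty (ne_one_of_brank_pos (q := q) (by omega))
    have h1 := brank_adjSwap_mul hi
    obtain ⟨j, hj⟩ := exists_eq_adjSwap_of_brank_eq_one (q := adjSwap i * q) (by omega)
    have hqe : q = adjSwap i * adjSwap j := by rw [← hj, adjSwap_mul_cancel]
    have hij : i ≠ j := by
      rintro rfl
      rw [adjSwap_mul_self] at hqe
      rw [hqe, brank_one] at hq
      omega
    by_cases hx : (i : ℕ) < j ∨ (i : ℕ) = j + 1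
    · exact ⟨(i, j), Finset.mem_coe.2 (Finset.mem_filter.2 ⟨Finset.mem_univ _, hx⟩), hqe.symm⟩
    · rw [ne_eq, Fin.ext_iff] at hij
      have hjq : j ∈ invDescents q := by
        rw [hqe, mem_invDescents_adjSwap_mul_of_far (by omega)]
        exact mem_invDescents_adjSwap j
      refine ⟨(j, i), Finset.mem_coe.2 (Finset.mem_filter.2 ⟨Finset.mem_univ _, Or.inl ?_⟩), ?_⟩
      · rw [Fin.lt_def]
        dsimp only
        omega
      · exact (hstep hq hjq hi (by rw [ne_eq, Fin.ext_iff]; omega)).2.symm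

lemma card_filter_mem_rankLevel_three (i : Fin m) :
    ((rankLevel m 3).filter fun q => i ∈ invDescents q).card = m.choose 2 := by
  have h1 := card_filter_mem_rankLevel_add i 2
  have h2 := card_filter_mem_rankLevel_add i 1
  have h3 := card_filter_mem_rankLevel_add i 0
  have h0 : ((rankLevel m 0).filter fun q => i ∈ invDescents q).card = 0 := by
    rw [Finset.card_eq_zero, Finset.filter_eq_empty_iff]
    intro q hq
    rw [eq_one_of_brank_eq_zero (mem_rankLevel.1 hq), invDescents_one]
    simp
  rw [card_rankLevel_two] at h1
  rw [card_rankLevel_one] at h2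
  rw [card_rankLevel_zero] at h3
  have := i.pos
  simp only [Nat.reduceAdd, zero_add] at h1 h2 h3
  omega

lemma card_filter_adjacent_le_one (hij : (i : ℕ) + 1 = j ∨ (j : ℕ) + 1 = i) :
    ((rankLevel m 3).filter fun q => i ∈ invDescents q ∧ j ∈ invDescents q).card ≤ 1 := by
  refine Finset.card_le_one.2 fun p hp q hq => ?_
  simp only [Finset.mem_filter, mem_rankLevel] at hp hq
  obtain ⟨hp, hpi, hpj⟩ := hp
  obtain ⟨hq, hqi, hqj⟩ := hq
  obtain hij | hij := hij
  · rw [eq_braid_of_mem_invDescents hp hpi hpj hij, eq_braid_of_mem_invDescents hq hqi hqj hij]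
  · rw [eq_braid_of_mem_invDescents hp hpj hpi hij, eq_braid_of_mem_invDescents hq hqj hqi hij]

lemma card_filter_pair_le (hm : 3 ≤ m) (hij : i ≠ j) :
    ((rankLevel m 3).filter fun q => i ∈ invDescents q ∧ j ∈ invDescents q).card ≤ m - 2 := by
  by_cases hadj : (i : ℕ) + 1 = j ∨ (j : ℕ) + 1 = i
  · exact (card_filter_adjacent_le_one hadj).trans (by omega)
  · have hfar : (i : ℕ) + 1 < j ∨ (j : ℕ) + 1 < i := by
      rw [ne_eq, Fin.ext_iff] at hij
      omega
    have hcard : ({i, j}ᶜ : Finset (Fin m)).card = m - 2 := by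
      rw [Finset.card_compl, Finset.card_pair hij, Fintype.card_fin]
    rw [← hcard]
    refine (Finset.card_le_card (t := ({i, j}ᶜ : Finset (Fin m)).image
      fun k => adjSwap i * (adjSwap j * adjSwap k)) ?_).trans Finset.card_image_le
    intro q hq
    simp only [Finset.mem_filter, mem_rankLevel] at hq
    obtain ⟨k, hki, hkj, rfl⟩ := eq_of_far_mem_invDescents hq.1 hq.2.1 hq.2.2 hfar
    exact Finset.mem_image_of_mem _ (by simp [hki, hkj])

lemma card_filter_invDescents_eq_pair_le (hij : i ≠ j) :
    ((rankLevel m 3).filter fun q => invDescents q = {i, j}).card ≤ 4 := by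
  by_cases hadj : (i : ℕ) + 1 = j ∨ (j : ℕ) + 1 = i
  · refine (Finset.card_le_card ?_).trans ((card_filter_adjacent_le_one hadj).trans (by omega))
    intro q hq
    rw [Finset.mem_filter] at hq ⊢
    exact ⟨hq.1, by simp [hq.2], by simp [hq.2]⟩
  · have hfar : (i : ℕ) + 1 < j ∨ (j : ℕ) + 1 < i := by
      rw [ne_eq, Fin.ext_iff] at hij
      omega
    let K : Finset (Fin m) := Finset.univ.filter fun k =>
      (k : ℕ) ∈ ({(i : ℕ) - 1, (i : ℕ) + 1, (j : ℕ) - 1, (j : ℕ) + 1} : Finset ℕ)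
    have hK : K.card ≤ 4 := (Finset.card_le_card_of_injOn (fun k : Fin m => (k : ℕ))
      (fun k hk => (Finset.mem_filter.1 hk).2) Fin.val_injective.injOn).trans Finset.card_le_four
    refine (Finset.card_le_card (t := K.image
      fun k => adjSwap i * (adjSwap j * adjSwap k)) ?_).trans (Finset.card_image_le.trans hK)
    intro q hq
    simp only [Finset.mem_filter, mem_rankLevel] at hq
    obtain ⟨hq, hd⟩ := hq
    obtain ⟨k, hki, hkj, rfl⟩ :=
      eq_of_far_mem_invDescents hq (by simp [hd] : i ∈ _) (by simp [hd] : j ∈ _) hfar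
    refine Finset.mem_image_of_mem _ (Finset.mem_filter.2 ⟨Finset.mem_univ _, ?_⟩)
    by_contra hk
    simp only [Finset.mem_insert, Finset.mem_singleton, not_or] at hk
    rw [ne_eq, Fin.ext_iff] at hki hkj
    have hmem : k ∈ invDescents (adjSwap i * (adjSwap j * adjSwap k)) := by
      rw [mem_invDescents_adjSwap_mul_of_far (by omega),
        mem_invDescents_adjSwap_mul_of_far (by omega)]
      exact mem_invDescents_adjSwap k
    rw [hd, Finset.mem_insert, Finset.mem_singleton, Fin.ext_iff, Fin.ext_iff] at hmem
    exact hmem.elim hki hkj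

end Counting

section Intersecting

variable {m : ℕ} {P : Finset (Equiv.Perm (Fin (m + 1)))}

lemma card_le_of_forall_exists_pair (hm : 3 ≤ m) (hP : P ⊆ rankLevel m 3)
    (L : Finset (Fin m × Fin m))
    (hL : ∀ q ∈ P, ∃ x ∈ L, x.1 ≠ x.2 ∧ x.1 ∈ invDescents q ∧ x.2 ∈ invDescents q) :
    P.card ≤ L.card * (m - 2) := by
  let F : Fin m × Fin m → Finset (Equiv.Perm (Fin (m + 1))) := fun x =>
    P.filter fun q => x.1 ≠ x.2 ∧ x.1 ∈ invDescents q ∧ x.2 ∈ invDescents q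
  refine (Finset.card_le_card (t := L.biUnion F) ?_).trans
    (Finset.card_biUnion_le_card_mul _ _ _ fun x _ => ?_)
  · intro q hq
    obtain ⟨x, hx, h⟩ := hL q hq
    exact Finset.mem_biUnion.2 ⟨x, hx, Finset.mem_filter.2 ⟨hq, h⟩⟩
  · by_cases hx : x.1 = x.2
    · simp [F, hx]
    · refine (Finset.card_le_card ?_).trans (card_filter_pair_le hm hx)
      intro q hq
      rw [Finset.mem_filter] at hq ⊢
      exact ⟨hP hq.1, hq.2.2⟩

lemma card_filter_card_eq_three_le (hP : P ⊆ rankLevel m 3) :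
    (P.filter fun q => (invDescents q).card = 3).card ≤
      ((Finset.powersetCard 3 (Finset.univ : Finset (Fin m))).filter fun s =>
        ∀ i : Fin m, i ∈ s → ∀ j : Fin m, j ∈ s → i ≠ j → (i : ℕ) + 1 < j ∨ (j : ℕ) + 1 < i).card := by
  refine Finset.card_le_card_of_injOn invDescents ?_ ?_
  · intro q hq
    obtain ⟨hq, hc⟩ := Finset.mem_filter.1 (Finset.mem_coe.1 hq)
    refine Finset.mem_coe.2 (Finset.mem_filter.2
      ⟨Finset.mem_powersetCard.2 ⟨Finset.subset_univ _, hc⟩, fun i hi j hj hij => ?_⟩)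
    exact far_of_card_invDescents_eq_brank (hc.trans (mem_rankLevel.1 (hP hq)).symm) hi hj hij
  · intro p hp q hq h
    obtain ⟨hp, -⟩ := Finset.mem_filter.1 (Finset.mem_coe.1 hp)
    obtain ⟨hq, hc⟩ := Finset.mem_filter.1 (Finset.mem_coe.1 hq)
    exact eq_of_invDescents_eq (mem_rankLevel.1 (hP hp)) (mem_rankLevel.1 (hP hq)) hc h

lemma card_le_choose_of_forall_card_eq_three (hP : P ⊆ rankLevel m 3)
    (hI : ∀ p ∈ P, ∀ q ∈ P, ∃ i ∈ invDescents p, i ∈ invDescents q)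
    (hc : ∀ q ∈ P, (invDescents q).card = 3) : P.card ≤ m.choose 2 := by
  have hinj : Set.InjOn invDescents (P : Set (Equiv.Perm (Fin (m + 1)))) := fun p hp q hq h =>
    eq_of_invDescents_eq (mem_rankLevel.1 (hP hp)) (mem_rankLevel.1 (hP hq)) (hc q hq) h
  rw [← Finset.card_image_of_injOn hinj]
  have hsized : ((P.image invDescents : Finset (Finset (Fin m))) :
      Set (Finset (Fin m))).Sized 3 := by
    intro s hs
    obtain ⟨q, hq, rfl⟩ := Finset.mem_image.1 (Finset.mem_coe.1 hs)
    exact hc q hq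
  by_cases hm : 6 ≤ m
  · refine (Finset.erdos_ko_rado ?_ hsized (by omega)).trans
      (Nat.choose_le_choose 2 (Nat.sub_le m 1))
    intro s hs t ht hst
    obtain ⟨p, hp, rfl⟩ := Finset.mem_image.1 (Finset.mem_coe.1 hs)
    obtain ⟨q, hq, rfl⟩ := Finset.mem_image.1 (Finset.mem_coe.1 ht)
    obtain ⟨i, hi, hi'⟩ := hI p hp q hq
    exact Finset.disjoint_left.1 hst hi hi'
  · have h := hsized.card_le
    rw [Fintype.card_fin] at h
    refine h.trans ?_
    have : m < 6 := by omega
    interval_cases m <;> decide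

lemma exists_eq_pair_of_mem {α : Type*} [DecidableEq α] {s : Finset α} {a : α}
    (hs : s.card = 2) (ha : a ∈ s) : ∃ b, b ≠ a ∧ s = {a, b} := by
  obtain ⟨x, y, hxy, rfl⟩ := Finset.card_eq_two.1 hs
  rw [Finset.mem_insert, Finset.mem_singleton] at ha
  obtain rfl | rfl := ha
  · exact ⟨y, hxy.symm, rfl⟩
  · exact ⟨x, hxy, Finset.pair_comm _ _⟩

lemma card_le_choose_of_three_pairs (hm : 3 ≤ m) (hP : P ⊆ rankLevel m 3)
    (hI : ∀ p ∈ P, ∀ q ∈ P, ∃ i ∈ invDescents p, i ∈ invDescents q)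
    (hns : ∀ i, ∃ q ∈ P, i ∉ invDescents q)
    (hE : 2 < ((P.image invDescents).filter fun s => s.card = 2).card) :
    P.card ≤ m.choose 2 := by
  have hchoose : 2 * m.choose 2 = m * (m - 1) := by
    rw [Nat.choose_two_right, Nat.mul_div_cancel' (Nat.even_mul_pred_self m).two_dvd]
  obtain ⟨e₁, h₁, e₂, h₂, e₃, h₃, h₁₂, h₁₃, h₂₃⟩ := Finset.two_lt_card.1 hE
  simp only [Finset.mem_filter, Finset.mem_image] at h₁ h₂ h₃
  obtain ⟨⟨p₁, hp₁, rfl⟩, hc₁⟩ := h₁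
  obtain ⟨⟨p₂, hp₂, rfl⟩, hc₂⟩ := h₂
  obtain ⟨⟨p₃, hp₃, rfl⟩, hc₃⟩ := h₃
  obtain ⟨a, ha₁, ha₂⟩ := hI p₁ hp₁ p₂ hp₂
  obtain ⟨b, hba, hb⟩ := exists_eq_pair_of_mem hc₁ ha₁
  obtain ⟨c, hca, hc⟩ := exists_eq_pair_of_mem hc₂ ha₂
  have hbc : b ≠ c := by
    rintro rfl
    exact h₁₂ (hb.trans hc.symm)
  have hab' : ∀ q ∈ P, a ∈ invDescents q ∨ b ∈ invDescents q := fun q hq => by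
    simpa [hb] using hI p₁ hp₁ q hq
  have hac' : ∀ q ∈ P, a ∈ invDescents q ∨ c ∈ invDescents q := fun q hq => by
    simpa [hc] using hI p₂ hp₂ q hq
  by_cases ha₃ : a ∈ invDescents p₃
  · obtain ⟨d, hda, hd⟩ := exists_eq_pair_of_mem hc₃ ha₃
    have hbd : b ≠ d := by
      rintro rfl
      exact h₁₃ (hb.trans hd.symm)
    have hcd : c ≠ d := by
      rintro rfl
      exact h₂₃ (hc.trans hd.symm)
    have had' : ∀ q ∈ P, a ∈ invDescents q ∨ d ∈ invDescents q := fun q hq => by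
      simpa [hd] using hI p₃ hp₃ q hq
    have hcard : ({b, c, d} : Finset (Fin m)).card = 3 :=
      Finset.card_eq_three.2 ⟨b, c, d, hbc, hbd, hcd, rfl⟩
    have hbcd : ∀ q ∈ P, a ∉ invDescents q → invDescents q = {b, c, d} := by
      intro q hq ha
      refine (Finset.eq_of_subset_of_card_le ?_ ?_).symm
      · simp [Finset.insert_subset_iff, (hab' q hq).resolve_left ha, (hac' q hq).resolve_left ha,
          (had' q hq).resolve_left ha]
      · rw [hcard, ← mem_rankLevel.1 (hP hq)]
        exact card_invDescents_le q
    obtain ⟨t, ht, hat⟩ := hns a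
    have htd := hbcd t ht hat
    have htr := mem_rankLevel.1 (hP ht)
    have htc : (invDescents t).card = brank (m + 1) t := by rw [htd, hcard, htr]
    have f₁ := far_of_card_invDescents_eq_brank htc (by simp [htd]) (by simp [htd]) hbc
    have f₂ := far_of_card_invDescents_eq_brank htc (by simp [htd]) (by simp [htd]) hbd
    have f₃ := far_of_card_invDescents_eq_brank htc (by simp [htd]) (by simp [htd]) hcd
    have hcov := card_le_of_forall_exists_pair (P := P.erase t) hm
      ((Finset.erase_subset _ _).trans hP) {(a, b), (a, c), (a, d)} (fun q hq => by
        obtain ⟨hqt, hq⟩ := Finset.mem_erase.1 hq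
        have haq : a ∈ invDescents q := by
          by_contra ha
          exact hqt (eq_of_invDescents_eq (mem_rankLevel.1 (hP hq)) htr (htc.trans htr)
            ((hbcd q hq ha).trans htd.symm))
        have hmeet := hI t ht q hq
        rw [htd] at hmeet
        simpa [haq, hba.symm, hca.symm, hda.symm] using hmeet)
    have hL : ({(a, b), (a, c), (a, d)} : Finset (Fin m × Fin m)).card ≤ 3 := Finset.card_le_three
    rw [Finset.card_erase_of_mem ht] at hcov
    have hcov' := hcov.trans (Nat.mul_le_mul_right _ hL)
    obtain ⟨k, rfl⟩ := Nat.exists_eq_add_of_le' (show 5 ≤ m by omega)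
    simp only [Nat.reduceSubDiff] at hchoose hcov'
    have : P.card ≤ 3 * (k + 3) + 1 := by omega
    nlinarith
  · have hb₃ : b ∈ invDescents p₃ := (hab' p₃ hp₃).resolve_left ha₃
    have hc₃' : c ∈ invDescents p₃ := (hac' p₃ hp₃).resolve_left ha₃
    have hd : {b, c} = invDescents p₃ := Finset.eq_of_subset_of_card_le
      (by simp [Finset.insert_subset_iff, hb₃, hc₃']) (by rw [hc₃, Finset.card_pair hbc])
    have hcov := card_le_of_forall_exists_pair hm hP {(a, b), (a, c), (b, c)} (by
      intro q hq
      have h1 := hab' q hq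
      have h2 := hac' q hq
      have h3 := hI p₃ hp₃ q hq
      rw [← hd] at h3
      simp only [Finset.mem_insert, Finset.mem_singleton, exists_eq_or_imp, exists_eq_left] at h3 ⊢
      have hab := hba.symm
      have hac := hca.symm
      clear hchoose hns hE hI hP hb hc hab' hac' hd
      tauto)
    have hcov' := hcov.trans (Nat.mul_le_mul_right _ Finset.card_le_three)
    obtain ⟨k, rfl⟩ := Nat.exists_eq_add_of_le' hm
    simp only [Nat.reduceSubDiff] at hchoose hcov'
    nlinarith [Nat.le_mul_self k]

lemma card_le_choose_of_pair (hm : 9 ≤ m) (hP : P ⊆ rankLevel m 3)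
    (hI : ∀ p ∈ P, ∀ q ∈ P, ∃ i ∈ invDescents p, i ∈ invDescents q)
    (hns : ∀ i, ∃ q ∈ P, i ∉ invDescents q) {p : Equiv.Perm (Fin (m + 1))} (hp : p ∈ P)
    (hc : (invDescents p).card = 2) : P.card ≤ m.choose 2 := by
  have hchoose : 2 * m.choose 2 = m * (m - 1) := by
    rw [Nat.choose_two_right, Nat.mul_div_cancel' (Nat.even_mul_pred_self m).two_dvd]
  obtain ⟨a, b, hab, hd⟩ := Finset.card_eq_two.1 hc
  have hab' : ∀ q ∈ P, a ∈ invDescents q ∨ b ∈ invDescents q := fun q hq => by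
    simpa [hd] using hI p hp q hq
  obtain ⟨t, ht, hat⟩ := hns a
  obtain ⟨u, hu, hbu⟩ := hns b
  have hbt := (hab' t ht).resolve_left hat
  have hau := (hab' u hu).resolve_right hbu
  have hcov := card_le_of_forall_exists_pair (by omega) hP
    ({(a, b)} ∪ (((invDescents t).erase b).image (Prod.mk a) ∪
      ((invDescents u).erase a).image (Prod.mk b))) (fun q hq => by
    by_cases haq : a ∈ invDescents q
    · by_cases hbq : b ∈ invDescents q
      · exact ⟨(a, b), by simp, hab, haq, hbq⟩
      · obtain ⟨y, hyt, hyq⟩ := hI t ht q hq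
        refine ⟨(a, y), ?_, fun (h : a = y) => hat (h ▸ hyt), haq, hyq⟩
        have hyb : y ≠ b := fun h => hbq (h ▸ hyq)
        simp [hyt, hyb]
    · have hbq := (hab' q hq).resolve_left haq
      obtain ⟨y, hyu, hyq⟩ := hI u hu q hq
      refine ⟨(b, y), ?_, fun (h : b = y) => hbu (h ▸ hyu), hbq, hyq⟩
      have hya : y ≠ a := fun h => haq (h ▸ hyq)
      simp [hyu, hya])
  have hL : ({(a, b)} ∪ (((invDescents t).erase b).image (Prod.mk a) ∪
      ((invDescents u).erase a).image (Prod.mk b)) : Finset (Fin m × Fin m)).card ≤ 5 := by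
    have h1 := Finset.card_union_le {(a, b)} (((invDescents t).erase b).image (Prod.mk a) ∪
      ((invDescents u).erase a).image (Prod.mk b))
    have h2 := Finset.card_union_le (((invDescents t).erase b).image (Prod.mk a))
      (((invDescents u).erase a).image (Prod.mk b))
    have h3 := Finset.card_image_le (s := (invDescents t).erase b) (f := Prod.mk a)
    have h4 := Finset.card_image_le (s := (invDescents u).erase a) (f := Prod.mk b)
    have h5 := card_invDescents_le t
    have h6 := card_invDescents_le u
    rw [Finset.card_erase_of_mem hbt] at h3
    rw [Finset.card_erase_of_mem hau] at h4
    rw [mem_rankLevel.1 (hP ht)] at h5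
    rw [mem_rankLevel.1 (hP hu)] at h6
    rw [Finset.card_singleton] at h1
    omega
  have hcov' := hcov.trans (Nat.mul_le_mul_right _ hL)
  obtain ⟨k, rfl⟩ := Nat.exists_eq_add_of_le' hm
  simp only [Nat.reduceSubDiff] at hchoose hcov'
  nlinarith

lemma card_filter_far_triples_add_le (hm : 3 ≤ m) (hm' : m ≤ 8) :
    ((Finset.powersetCard 3 (Finset.univ : Finset (Fin m))).filter fun s =>
      ∀ i : Fin m, i ∈ s → ∀ j : Fin m, j ∈ s → i ≠ j →
        (i : ℕ) + 1 < j ∨ (j : ℕ) + 1 < i).card + min 8 ((m - 2) * 2) ≤ m.choose 2 := by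
  interval_cases m <;> decide +kernel

lemma card_le_choose_of_le_two_pairs (hm : 3 ≤ m) (hm' : m ≤ 8) (hP : P ⊆ rankLevel m 3)
    (hc : ∀ q ∈ P, (invDescents q).card = 2 ∨ (invDescents q).card = 3)
    (hE : ((P.image invDescents).filter fun s => s.card = 2).card ≤ 2) :
    P.card ≤ m.choose 2 := by
  have hthree := card_filter_card_eq_three_le hP
  have hsplit : P.card = (P.filter fun q => (invDescents q).card = 2).card +
      (P.filter fun q => (invDescents q).card = 3).card := by
    rw [← Finset.card_filter_add_card_filter_not (s := P) fun q => (invDescents q).card = 2]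
    congr 2
    refine Finset.filter_congr fun q hq => ?_
    have := hc q hq
    omega
  have htwo : ∀ N, (∀ i j : Fin m, i ≠ j →
      ((rankLevel m 3).filter fun q => invDescents q = {i, j}).card ≤ N) →
      (P.filter fun q => (invDescents q).card = 2).card ≤ N * 2 := by
    intro N hN
    refine (Finset.card_le_mul_card_image (f := invDescents) _ N ?_).trans
      (Nat.mul_le_mul_left _ (le_trans (Finset.card_le_card ?_) hE))
    · intro s hs
      obtain ⟨q, hq, rfl⟩ := Finset.mem_image.1 hs
      obtain ⟨i, j, hij, hd⟩ := Finset.card_eq_two.1 (Finset.mem_filter.1 hq).2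
      refine (Finset.card_le_card ?_).trans (hN i j hij)
      intro r hr
      simp only [Finset.mem_filter] at hr ⊢
      exact ⟨hP hr.1.1, hr.2.trans hd⟩
    · intro s hs
      obtain ⟨q, hq, rfl⟩ := Finset.mem_image.1 hs
      obtain ⟨hq, hq'⟩ := Finset.mem_filter.1 hq
      exact Finset.mem_filter.2 ⟨Finset.mem_image_of_mem _ hq, hq'⟩
  have h4 := htwo 4 fun i j hij => card_filter_invDescents_eq_pair_le hij
  have hm2 := htwo (m - 2) fun i j hij => by
    refine (Finset.card_le_card ?_).trans (card_filter_pair_le hm hij)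
    intro q hq
    rw [Finset.mem_filter] at hq ⊢
    exact ⟨hq.1, by simp [hq.2], by simp [hq.2]⟩
  have hfar := card_filter_far_triples_add_le hm hm'
  omega

lemma card_le_choose_of_intersecting (hm : 2 ≤ m) (hP : P ⊆ rankLevel m 3)
    (hI : ∀ p ∈ P, ∀ q ∈ P, ∃ i ∈ invDescents p, i ∈ invDescents q) :
    P.card ≤ m.choose 2 := by
  by_cases hstar : ∃ i, ∀ q ∈ P, i ∈ invDescents q
  · obtain ⟨i, hi⟩ := hstar
    rw [← card_filter_mem_rankLevel_three i]
    exact Finset.card_le_card fun q hq => Finset.mem_filter.2 ⟨hP hq, hi q hq⟩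
  have hns : ∀ i, ∃ q ∈ P, i ∉ invDescents q := by
    intro i
    by_contra! h
    exact hstar ⟨i, h⟩
  have hc : ∀ q ∈ P, (invDescents q).card = 2 ∨ (invDescents q).card = 3 := by
    intro q hq
    have h3 := card_invDescents_le q
    rw [mem_rankLevel.1 (hP hq)] at h3
    have h0 : (invDescents q).card ≠ 0 := by
      obtain ⟨i, hi, -⟩ := hI q hq q hq
      exact Finset.card_ne_zero_of_mem hi
    have h1 : (invDescents q).card ≠ 1 := by
      intro h
      obtain ⟨i, hi⟩ := Finset.card_eq_one.1 h
      refine hstar ⟨i, fun r hr => ?_⟩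
      simpa [hi] using hI q hq r hr
    omega
  have hm3 : 3 ≤ m := by
    obtain ⟨q, hq, hi⟩ := hns ⟨0, by omega⟩
    have h := Finset.card_lt_univ_of_notMem hi
    rw [Fintype.card_fin] at h
    have := hc q hq
    omega
  by_cases hE : 2 < ((P.image invDescents).filter fun s => s.card = 2).card
  · exact card_le_choose_of_three_pairs hm3 hP hI hns hE
  · by_cases h9 : 9 ≤ m
    · by_cases hp : ∃ p ∈ P, (invDescents p).card = 2
      · obtain ⟨p, hp, hp2⟩ := hp
        exact card_le_choose_of_pair h9 hP hI hns hp hp2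
      · exact card_le_choose_of_forall_card_eq_three hP hI fun q hq =>
          (hc q hq).resolve_left fun h => hp ⟨q, hq, h⟩
    · exact card_le_choose_of_le_two_pairs hm3 (by omega) hP hc (by omega)

end Intersecting

/-- For `n ≥ 3`, the level `B_3(n)` is EKR: every intersecting family of rank-3
permutations has size at most `C(n-1, 2)`, and this bound is attained by the star
of some rank-1 permutation. -/
theorem stmt_16 (n : ℕ) (hn : 3 ≤ n) :
    (∀ P : Set (Equiv.Perm (Fin n)), (∀ p ∈ P, brank n p = 3) → BInter n P →
      Nat.card P ≤ Nat.choose (n - 1) 2) ∧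
    (∃ p : Equiv.Perm (Fin n), brank n p = 1 ∧
      BInter n {q | brank n q = 3 ∧ BLE p q} ∧
      Nat.card {q : Equiv.Perm (Fin n) | brank n q = 3 ∧ BLE p q} =
        Nat.choose (n - 1) 2) := by
  obtain ⟨m, rfl⟩ : ∃ m, n = m + 1 := ⟨n - 1, by omega⟩
  rw [Nat.add_sub_cancel]
  refine ⟨fun P hP hI => ?_, ?_⟩
  · classical
    rw [Nat.card_eq_card_toFinset]
    refine card_le_choose_of_intersecting (by omega) (fun q hq => ?_) fun p hp q hq => ?_
    · exact mem_rankLevel.2 (hP q (Set.mem_toFinset.1 hq))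
    · obtain ⟨r, hr, hrp, hrq⟩ := hI p (Set.mem_toFinset.1 hp) q (Set.mem_toFinset.1 hq)
      obtain ⟨i, hi⟩ := invDescents_nonempty hr
      exact ⟨i, invDescents_subset_of_BLE hrp hi, invDescents_subset_of_BLE hrq hi⟩
  · let i : Fin m := ⟨0, by omega⟩
    refine ⟨adjSwap i, brank_adjSwap i, fun p hp q hq => ⟨adjSwap i, ?_, hp.2, hq.2⟩, ?_⟩
    · exact ne_one_of_brank_pos (by rw [brank_adjSwap]; exact one_pos)
    · rw [← card_filter_mem_rankLevel_three i, ← Nat.card_eq_finsetCard]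
      refine Nat.card_congr (Equiv.subtypeEquivRight fun q => ?_)
      rw [Finset.mem_filter, mem_rankLevel, ← BLE_adjSwap_iff]
      rfl
end

section
/- For integers r, n with 3 ≤ r ≤ n−1 and every permutation p ∈ B_1(n) (i.e., rank(p) = 1), the number of permutations q ∈ B_r(n) with p ≼ q is strictly greater than C(n−2, r−1). -/
/-- The Lehmer code of `p` by values: the number of smaller values that `v` precedes. -/
def lehmerCode {n : ℕ} (p : Equiv.Perm (Fin n)) (v : Fin n) : ℕ :=
  (Finset.univ.filter (fun u => u < v ∧ p.symm v < p.symm u)).card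

theorem lehmerCode_le {n : ℕ} (p : Equiv.Perm (Fin n)) (v : Fin n) :
    lehmerCode p v ≤ v := by
  calc lehmerCode p v ≤ (Finset.Iio v).card :=
        Finset.card_le_card fun u hu => by simp at hu ⊢; exact hu.1
    _ = v := by simp

theorem brank_eq_sum_lehmerCode {n : ℕ} (p : Equiv.Perm (Fin n)) :
    brank n p = ∑ v, lehmerCode p v := by
  simp only [brank, InvSet, lehmerCode, Finset.card_filter, Fintype.sum_prod_type_right]

theorem symm_lt_symm_of_lehmerCode_lt {n : ℕ} (q : Equiv.Perm (Fin n)) {a b : Fin n}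
    (hab : (b : ℕ) = a + 1) (h : lehmerCode q a < lehmerCode q b) : q.symm b < q.symm a := by
  by_contra hba
  refine absurd h (not_lt.2 (Finset.card_le_card fun u hu => ?_))
  simp only [Finset.mem_filter, Finset.mem_univ, true_and] at hu ⊢
  have hlt := lt_of_le_of_lt (not_lt.1 hba) hu.2
  have hne : u ≠ a := fun e => by subst e; exact lt_irrefl _ hlt
  exact ⟨by omega, hlt⟩

theorem symm_lt_symm_iff_of_lehmerCode_eq {n : ℕ} {p q : Equiv.Perm (Fin n)}
    (h : lehmerCode p = lehmerCode q) (k : ℕ) :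
    ∀ u v : Fin n, (u : ℕ) < k → (v : ℕ) < k →
      (p.symm u < p.symm v ↔ q.symm u < q.symm v) := by
  induction k with
  | zero => intro u v hu; omega
  | succ k ih =>
    have last : ∀ u v : Fin n, (v : ℕ) = k → u < v →
        (p.symm v < p.symm u ↔ q.symm v < q.symm u) := by
      intro u v hv huv
      set S := Finset.univ.filter (fun u => u < v ∧ p.symm v < p.symm u) with hS
      set T := Finset.univ.filter (fun u => u < v ∧ q.symm v < q.symm u) with hT
      have hcard : S.card = T.card := congrFun h v
      have hST : S = T := by
        by_cases hsub : S ⊆ T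
        · exact Finset.eq_of_subset_of_card_le hsub hcard.ge
        by_cases hsub' : T ⊆ S
        · exact (Finset.eq_of_subset_of_card_le hsub' hcard.le).symm
        obtain ⟨x, hx, hx'⟩ := Finset.not_subset.1 hsub
        obtain ⟨y, hy, hy'⟩ := Finset.not_subset.1 hsub'
        simp only [hS, hT, Finset.mem_filter, Finset.mem_univ, true_and, not_and, not_lt]
          at hx hx' hy hy'
        have h1 := lt_of_le_of_lt (hy' hy.1) hx.2
        have h2 := lt_of_le_of_lt (hx' hx.1) hy.2
        have h3 := (ih y x (by omega) (by omega)).1 h1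
        exact absurd h2 h3.asymm
      have := Finset.ext_iff.1 hST u
      simpa [hS, hT, huv] using this
    have last' : ∀ u v : Fin n, (v : ℕ) = k → u < v →
        (p.symm u < p.symm v ↔ q.symm u < q.symm v) := by
      intro u v hv huv
      have hp := p.symm.injective.ne huv.ne
      have hq := q.symm.injective.ne huv.ne
      have := last u v hv huv
      rw [← not_iff_not, not_lt, not_lt, hp.symm.le_iff_lt, hq.symm.le_iff_lt, this]
    intro u v hu hv
    rcases lt_trichotomy u v with huv | huv | huv
    · by_cases hk : (v : ℕ) = k
      · exact last' u v hk huv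
      · exact ih u v (by omega) (by omega)
    · subst huv; simp
    · by_cases hk : (u : ℕ) = k
      · exact last v u hk huv
      · exact ih u v (by omega) (by omega)

theorem lehmerCode_injective (n : ℕ) :
    Function.Injective (lehmerCode : Equiv.Perm (Fin n) → Fin n → ℕ) := by
  intro p q h
  have key : ∀ x y : Fin n, q.symm (p x) < q.symm (p y) ↔ x < y := fun x y => by
    simpa using (symm_lt_symm_iff_of_lehmerCode_eq h n (p x) (p y) (p x).2 (p y).2).symm
  have hmono : StrictMono fun x => q.symm (p x) := fun x y hxy => (key x y).2 hxy
  have hid : (p.trans q.symm : Fin n → Fin n) = id :=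
    hmono.range_inj strictMono_id |>.1 (by
      rw [Set.range_id]; exact (p.trans q.symm).surjective.range_eq)
  ext x
  have := congrFun hid x
  simp only [Equiv.coe_trans, Function.comp_apply, id, Equiv.symm_apply_eq] at this
  rw [this]

theorem exists_lehmerCode_eq {n : ℕ} (c : Fin n → ℕ) (hc : ∀ v, c v ≤ v) :
    ∃ p : Equiv.Perm (Fin n), lehmerCode p = c := by
  let F : Equiv.Perm (Fin n) → (v : Fin n) → Fin ((v : ℕ) + 1) :=
    fun p v => ⟨lehmerCode p v, Nat.lt_succ_of_le (lehmerCode_le p v)⟩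
  have hF : Function.Injective F := fun p q h =>
    lehmerCode_injective n (funext fun v => congrArg Fin.val (congrFun h v))
  have hbij : Function.Bijective F := by
    refine (Fintype.bijective_iff_injective_and_card F).2 ⟨hF, ?_⟩
    rw [Fintype.card_perm, Fintype.card_fin, Fintype.card_pi]
    simp only [Fintype.card_fin]
    rw [Fin.prod_univ_eq_prod_range (fun i => i + 1) n, Finset.prod_range_add_one_eq_factorial]
  obtain ⟨p, hp⟩ := hbij.2 fun v => ⟨c v, Nat.lt_succ_of_le (hc v)⟩
  exact ⟨p, funext fun v => congrArg Fin.val (congrFun hp v)⟩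

/-- A permutation of rank one has exactly one inversion, and it is between adjacent values. -/
theorem exists_invSet_eq_of_brank_eq_one {n : ℕ} {p : Equiv.Perm (Fin n)}
    (hp : brank n p = 1) :
    ∃ a b : Fin n, (b : ℕ) = a + 1 ∧ InvSet n p = {(a, b)} := by
  obtain ⟨⟨a, b⟩, h⟩ := Finset.card_eq_one.1 hp
  have hmem : ∀ x y : Fin n, x < y → p.symm y < p.symm x → x = a ∧ y = b := by
    intro x y h1 h2
    have : (x, y) ∈ InvSet n p := by simp [InvSet, h1, h2]
    simpa [h] using this
  have hab : a < b ∧ p.symm b < p.symm a := by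
    have : (a, b) ∈ InvSet n p := by simp [h]
    simpa [InvSet] using this
  refine ⟨a, b, ?_, h⟩
  by_contra hne
  let c : Fin n := ⟨a + 1, by omega⟩
  have hac : a < c := Fin.lt_def.2 (by simp [c])
  have hcb : c < b := Fin.lt_def.2 (by have := Fin.lt_def.1 hab.1; simp only [c]; omega)
  rcases lt_or_ge (p.symm c) (p.symm a) with h1 | h1
  · exact hcb.ne (hmem a c hac h1).2
  · exact hac.ne' (hmem c b hcb (hab.2.trans_le h1)).1

/-- The code given by the indicator of `S` with the entry at `x` raised by one. -/
def raisedIndicator {n : ℕ} (S : Finset (Fin n)) (x : Fin n) (v : Fin n) : ℕ :=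
  (if v ∈ S then 1 else 0) + (if v = x then 1 else 0)

theorem sum_raisedIndicator {n : ℕ} (S : Finset (Fin n)) (x : Fin n) :
    ∑ v, raisedIndicator S x v = S.card + 1 := by
  simp [raisedIndicator, Finset.sum_add_distrib]

theorem raisedIndicator_injective {n : ℕ} (x : Fin n) :
    Function.Injective fun S : Finset (Fin n) => raisedIndicator S x := by
  intro S T h
  ext v
  have := congrFun h v
  simp only [raisedIndicator, add_left_inj] at this
  by_cases h1 : v ∈ S <;> by_cases h2 : v ∈ T <;> simp_all

theorem raisedIndicator_le {n : ℕ} {S : Finset (Fin n)} {x : Fin n}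
    (h0 : ∀ v ∈ S, 1 ≤ (v : ℕ)) (hx : 1 ≤ (x : ℕ)) (hxS : x ∈ S → 2 ≤ (x : ℕ)) (v : Fin n) :
    raisedIndicator S x v ≤ v := by
  unfold raisedIndicator
  by_cases hv : v = x
  · subst hv
    by_cases h : v ∈ S
    · simpa [h] using hxS h
    · simpa [h] using hx
  · by_cases h : v ∈ S
    · simpa [h, hv] using h0 v h
    · simp [h, hv]

/-- A family of distinct codes of sum `r` that increase from `a` to `a + 1` bounds from below
the number of permutations of rank `r` above the transposition of these values. -/
theorem card_le_card_of_codes {n r : ℕ} {p : Equiv.Perm (Fin n)} {a b : Fin n}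
    (hab : (b : ℕ) = a + 1) (hp : InvSet n p = {(a, b)}) (K : Finset (Fin n → ℕ))
    (hK : ∀ c ∈ K, (∀ v, c v ≤ v) ∧ ∑ v, c v = r ∧ c a < c b) :
    K.card ≤ Nat.card {q : Equiv.Perm (Fin n) | brank n q = r ∧ BLE p q} := by
  classical
  rw [Nat.card_coe_set_eq, ← Set.ncard_coe_finset K]
  refine (Set.ncard_le_ncard ?_ (Set.toFinite _)).trans
    (Set.ncard_image_le (f := lehmerCode) (Set.toFinite _))
  intro c hc
  obtain ⟨h1, h2, h3⟩ := hK c hc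
  obtain ⟨q, rfl⟩ := exists_lehmerCode_eq c h1
  refine ⟨q, ⟨(brank_eq_sum_lehmerCode q).trans h2, ?_⟩, rfl⟩
  have hlt : a < b := Fin.lt_def.2 (by omega)
  rw [BLE, hp, Finset.singleton_subset_iff]
  simp [InvSet, hlt, symm_lt_symm_of_lehmerCode_lt q hab h3]

/-- Raised indicators of the `(r - 1)`-subsets avoiding `0` and `z`, together with one further
raised indicator, give more than `C(n - 2, r - 1)` permutations. -/
theorem choose_lt_card_of_extra {n r : ℕ} (hr : 1 ≤ r) {p : Equiv.Perm (Fin n)} {a b o z : Fin n}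
    (hab : (b : ℕ) = a + 1) (hp : InvSet n p = {(a, b)}) (ho : (o : ℕ) = 0) (hoz : o ≠ z)
    (ha : a = o ∨ a = z) (hb : (b : ℕ) = 1 → b = z)
    {S : Finset (Fin n)} {x : Fin n} (hS : S.card + 1 = r) (hS0 : ∀ v ∈ S, 1 ≤ (v : ℕ))
    (hx : 2 ≤ (x : ℕ)) (hSab : raisedIndicator S x a < raisedIndicator S x b)
    {w : Fin n} (hw : ∀ T : Finset (Fin n), o ∉ T → z ∉ T →
      raisedIndicator T b w ≠ raisedIndicator S x w) :
    Nat.choose (n - 2) (r - 1) <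
      Nat.card {q : Equiv.Perm (Fin n) | brank n q = r ∧ BLE p q} := by
  classical
  let U : Finset (Fin n) := Finset.univ \ {o, z}
  let K₀ := (U.powersetCard (r - 1)).image fun T => raisedIndicator T b
  have hU : U.card = n - 2 := by
    rw [Finset.card_sdiff_of_subset (Finset.subset_univ _), Finset.card_pair hoz]; simp
  have hmem : ∀ T ∈ U.powersetCard (r - 1), o ∉ T ∧ z ∉ T ∧ T.card + 1 = r := by
    intro T hT
    rw [Finset.mem_powersetCard] at hT
    refine ⟨fun h => ?_, fun h => ?_, by omega⟩
    · simpa [U] using hT.1 h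
    · simpa [U] using hT.1 h
  have hK₀ : K₀.card = Nat.choose (n - 2) (r - 1) := by
    rw [Finset.card_image_of_injective _ (raisedIndicator_injective b),
      Finset.card_powersetCard, hU]
  have hnot : raisedIndicator S x ∉ K₀ := by
    intro h
    obtain ⟨T, hT, hTS⟩ := Finset.mem_image.1 h
    exact hw T (hmem T hT).1 (hmem T hT).2.1 (congrFun hTS w)
  have hcard := card_le_card_of_codes (r := r) hab hp (insert (raisedIndicator S x) K₀) ?_
  · rw [Finset.card_insert_of_notMem hnot, hK₀] at hcard
    exact hcard
  intro c hc
  rcases Finset.mem_insert.1 hc with rfl | hc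
  · exact ⟨raisedIndicator_le hS0 (by omega) fun _ => hx,
      (sum_raisedIndicator S x).trans hS, hSab⟩
  · obtain ⟨T, hT, rfl⟩ := Finset.mem_image.1 hc
    obtain ⟨hoT, hzT, hTr⟩ := hmem T hT
    refine ⟨raisedIndicator_le ?_ (by omega) ?_, (sum_raisedIndicator T b).trans hTr, ?_⟩
    · intro v hv
      by_contra h
      have : v = o := Fin.ext (by omega)
      exact hoT (this ▸ hv)
    · intro hbT
      by_contra h
      exact hzT (hb (by omega) ▸ hbT)
    · have haT : a ∉ T := by rcases ha with rfl | rfl <;> assumption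
      have hne : a ≠ b := fun e => by rw [e] at hab; omega
      simp [raisedIndicator, haT, hne]

/-- A set containing two given nonzero values and of prescribed size, avoiding `0`. -/
theorem exists_finset_pair_subset {n k : ℕ} {x y : Fin n} (hx : 1 ≤ (x : ℕ)) (hy : 1 ≤ (y : ℕ))
    (hk : 2 ≤ k) (hkn : k ≤ n - 1) :
    ∃ S : Finset (Fin n), x ∈ S ∧ y ∈ S ∧ S.card = k ∧ ∀ v ∈ S, 1 ≤ (v : ℕ) := by
  classical
  let o : Fin n := ⟨0, by omega⟩
  have hsub : ({x, y} : Finset (Fin n)) ⊆ Finset.univ.erase o := by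
    intro v hv
    simp only [Finset.mem_insert, Finset.mem_singleton] at hv
    refine Finset.mem_erase.2 ⟨fun e => ?_, Finset.mem_univ _⟩
    have : (v : ℕ) = 0 := by simp [e, o]
    rcases hv with rfl | rfl <;> omega
  obtain ⟨S, h1, h2, h3⟩ := Finset.exists_subsuperset_card_eq hsub
    (Finset.card_le_two.trans hk) (by simpa using hkn)
  refine ⟨S, h1 (by simp), h1 (by simp), h3, fun v hv => ?_⟩
  by_contra h
  exact (Finset.mem_erase.1 (h2 hv)).1 (Fin.ext (by simp [o]; omega))

/-- For `3 ≤ r ≤ n-1` and any rank-1 permutation `p`, the number of rank-`r`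
permutations above `p` in the weak Bruhat order is strictly greater than `C(n-2, r-1)`. -/
theorem stmt_17 (n r : ℕ) (hr : 3 ≤ r) (hrn : r ≤ n - 1) (p : Equiv.Perm (Fin n))
    (hp : brank n p = 1) :
    Nat.choose (n - 2) (r - 1) <
      Nat.card {q : Equiv.Perm (Fin n) | brank n q = r ∧ BLE p q} := by
  obtain ⟨a, b, hab, hInv⟩ := exists_invSet_eq_of_brank_eq_one hp
  let o : Fin n := ⟨0, by omega⟩
  have hne : a ≠ b := fun e => by rw [e] at hab; omega
  rcases Nat.eq_zero_or_pos (a : ℕ) with ha | ha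
  · have hao : a = o := Fin.ext ha
    let t : Fin n := ⟨2, by omega⟩
    have ht : (t : ℕ) = 2 := rfl
    obtain ⟨S, hbS, htS, hcard, hS0⟩ :=
      exists_finset_pair_subset (n := n) (k := r - 1) (x := b) (y := t)
        (by omega) (by omega) (by omega) (by omega)
    have haS : a ∉ S := fun h => by have := hS0 a h; omega
    have hat : a ≠ t := fun e => by rw [e] at ha; omega
    have hbt : b ≠ t := fun e => by rw [e] at hab; omega
    refine choose_lt_card_of_extra (o := o) (z := b) (S := S) (x := t) (w := t) (by omega)
      hab hInv rfl (hao ▸ hne) (Or.inl hao) (fun _ => rfl) (by omega) hS0 ht.ge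
      (by simp [raisedIndicator, haS, hbS, hat]) ?_
    intro T _ _
    by_cases h : t ∈ T <;> simp [raisedIndicator, htS, hbt.symm, h]
  · obtain ⟨S, haS, hbS, hcard, hS0⟩ :=
      exists_finset_pair_subset (n := n) (k := r - 1) (x := a) (y := b)
        (by omega) (by omega) (by omega) (by omega)
    refine choose_lt_card_of_extra (o := o) (z := a) (S := S) (x := b) (w := a) (by omega)
      hab hInv rfl (fun e => ?_) (Or.inr rfl) (fun h => by omega) (by omega) hS0 (by omega)
      (by simp [raisedIndicator, haS, hbS, hne]) ?_
    · rw [← e] at ha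
      exact absurd ha (lt_irrefl 0)
    · intro T _ haT
      simp [raisedIndicator, haS, haT, hne]
end

section
/- Let ℓ, r, n be integers with 2 ≤ ℓ < r and n ≥ (2r+1)(ℓ−1) − (r−2), and let F be an intersecting system of ℓ-element subsets of an (n−1)-element set. If |F| > C(n−2, ℓ−1) − C(n−2−r, ℓ−1), then there is an element x contained in every member of F, and F contains at least r+1 sets F_1, …, F_{r+1} such that F_i ∩ F_j = {x} for all i ≠ j. -/
namespace ShiftedFamilies

open Finset Equiv

/-- No choice of one member from each family of `F` is pairwise disjoint. -/
def CrossDependent {ι : Type*} (F : ι → Finset (Finset ℕ)) : Prop :=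
  ∀ g : ι → Finset ℕ, (∀ a, g a ∈ F a) → ∃ a b, a ≠ b ∧ ¬ Disjoint (g a) (g b)

/-- `F` is closed under replacing an element by a smaller element of `Y`. -/
def Shifted (Y : Finset ℕ) (F : Finset (Finset ℕ)) : Prop :=
  ∀ A ∈ F, ∀ j ∈ A, ∀ i ∈ Y, i < j → i ∉ A → insert i (A.erase j) ∈ F

/-- Replace `j` by `i` where this is possible. -/
def push (i j : ℕ) (A : Finset ℕ) : Finset ℕ :=
  if j ∈ A ∧ i ∉ A then A.image (swap i j) else A

/-- The member of the `(i, j)`-shift of `F` that comes from `A`. -/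
def shiftSet (i j : ℕ) (F : Finset (Finset ℕ)) (A : Finset ℕ) : Finset ℕ :=
  if push i j A ∈ F then A else push i j A

/-- The `(i, j)`-shift of the family `F`. -/
def shift (i j : ℕ) (F : Finset (Finset ℕ)) : Finset (Finset ℕ) :=
  F.image (shiftSet i j F)

lemma image_swap_eq_insert_erase {i j : ℕ} {A : Finset ℕ} (hj : j ∈ A) (hi : i ∉ A) :
    A.image (swap i j) = insert i (A.erase j) := by
  have h : ∀ x ∈ A.erase j, swap i j x = x := fun x hx =>
    swap_apply_of_ne_of_ne (fun h => hi (h ▸ mem_of_mem_erase hx)) (ne_of_mem_erase hx)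
  conv_lhs => rw [← insert_erase hj, image_insert, swap_apply_right, image_congr h, image_id']

lemma image_swap_eq_self {i j : ℕ} {A : Finset ℕ} (hj : j ∉ A) (hi : i ∉ A) :
    A.image (swap i j) = A := by
  have h : ∀ x ∈ A, swap i j x = x := fun x hx =>
    swap_apply_of_ne_of_ne (fun h => hi (h ▸ hx)) (fun h => hj (h ▸ hx))
  rw [image_congr h, image_id']

lemma image_swap_image_swap (i j : ℕ) (A : Finset ℕ) :
    (A.image (swap i j)).image (swap i j) = A := by
  rw [image_image]
  ext x
  simp

lemma shiftSet_cases {i j : ℕ} {F : Finset (Finset ℕ)} {A : Finset ℕ} (hA : A ∈ F) :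
    (shiftSet i j F A = A ∧ (j ∈ A → i ∉ A → A.image (swap i j) ∈ F)) ∨
    (j ∈ A ∧ i ∉ A ∧ A.image (swap i j) ∉ F ∧ shiftSet i j F A = A.image (swap i j)) := by
  unfold shiftSet push
  split_ifs <;> grind

lemma injOn_shiftSet (i j : ℕ) (F : Finset (Finset ℕ)) : Set.InjOn (shiftSet i j F) F := by
  intro A hA B hB h
  have hinj : Function.Injective (fun A : Finset ℕ => A.image (swap i j)) :=
    image_injective (swap i j).injective
  rcases shiftSet_cases (i := i) (j := j) hA with ⟨h1, -⟩ | ⟨-, -, h2, h1⟩ <;>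
  rcases shiftSet_cases (i := i) (j := j) hB with ⟨h3, -⟩ | ⟨-, -, h4, h3⟩ <;>
  rw [h1, h3] at h
  · exact h
  · exact absurd (h ▸ hA) h4
  · exact absurd (h ▸ hB) h2
  · exact hinj h

lemma card_shift (i j : ℕ) (F : Finset (Finset ℕ)) : (shift i j F).card = F.card :=
  card_image_of_injOn (injOn_shiftSet i j F)

lemma shift_subset_powersetCard {i j k : ℕ} {Y : Finset ℕ} {F : Finset (Finset ℕ)}
    (hi : i ∈ Y) (hF : F ⊆ powersetCard k Y) : shift i j F ⊆ powersetCard k Y := by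
  intro B hB
  obtain ⟨A, hA, rfl⟩ := mem_image.1 hB
  rcases shiftSet_cases (i := i) (j := j) hA with ⟨h, -⟩ | ⟨hj, hi', -, h⟩
  · rw [h]; exact hF hA
  · have hA' := mem_powersetCard.1 (hF hA)
    rw [h, mem_powersetCard, card_image_of_injective _ (swap i j).injective]
    refine ⟨?_, hA'.2⟩
    rw [image_swap_eq_insert_erase hj hi']
    exact insert_subset hi ((erase_subset _ _).trans hA'.1)

lemma CrossDependent.shift {ι : Type*} {F : ι → Finset (Finset ℕ)} (hF : CrossDependent F)
    (i j : ℕ) : CrossDependent (fun a => shift i j (F a)) := by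
  intro g hg
  by_contra! hdis
  have key : ∀ a, (g a ∈ F a ∧ (j ∈ g a → i ∉ g a → (g a).image (swap i j) ∈ F a)) ∨
      (i ∈ g a ∧ (g a).image (swap i j) ∈ F a) := by
    intro a
    obtain ⟨A, hA, h⟩ := mem_image.1 (hg a)
    rcases shiftSet_cases (i := i) (j := j) hA with ⟨h1, h2⟩ | ⟨hj, hi', -, h1⟩
    · left
      rw [← h, h1]; exact ⟨hA, h2⟩
    · right
      rw [← h, h1, image_swap_image_swap]
      refine ⟨?_, hA⟩
      rw [image_swap_eq_insert_erase hj hi']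
      exact mem_insert_self _ _
  by_cases hall : ∀ a, g a ∈ F a
  · obtain ⟨a, b, hab, h⟩ := hF g hall
    exact h (hdis a b hab)
  push Not at hall
  obtain ⟨b, hb⟩ := hall
  have hib : i ∈ g b ∧ (g b).image (swap i j) ∈ F b := by
    rcases key b with h | h
    · exact absurd h.1 hb
    · exact h
  obtain ⟨a, c, hac, h⟩ := hF (fun a => (g a).image (swap i j)) (by
    intro a
    by_cases hab : a = b
    · subst hab; exact hib.2
    have hia : i ∉ g a := fun h => (disjoint_left.1 (hdis a b hab) h) hib.1
    rcases key a with h | h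
    · by_cases hj : j ∈ g a
      · exact h.2 hj hia
      · change (g a).image (swap i j) ∈ F a
        rw [image_swap_eq_self hj hia]; exact h.1
    · exact h.2)
  exact h ((disjoint_image (swap i j).injective).2 (hdis a c hac))

lemma sum_shiftSet_le {i j : ℕ} (hij : i < j) {F : Finset (Finset ℕ)} {A : Finset ℕ}
    (hA : A ∈ F) : ∑ x ∈ shiftSet i j F A, x ≤ ∑ x ∈ A, x ∧
      (shiftSet i j F A ≠ A → ∑ x ∈ shiftSet i j F A, x < ∑ x ∈ A, x) := by
  rcases shiftSet_cases (i := i) (j := j) hA with ⟨h, -⟩ | ⟨hj, hi', -, h⟩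
  · simp [h]
  · have h1 : ∑ x ∈ shiftSet i j F A, x < ∑ x ∈ A, x := by
      rw [h, image_swap_eq_insert_erase hj hi', sum_insert (by simp [hi']),
        ← add_sum_erase A _ hj]
      omega
    exact ⟨h1.le, fun _ => h1⟩

lemma sum_shift_le {i j : ℕ} (hij : i < j) (F : Finset (Finset ℕ)) :
    ∑ A ∈ shift i j F, ∑ x ∈ A, x ≤ ∑ A ∈ F, ∑ x ∈ A, x := by
  rw [shift, sum_image (injOn_shiftSet i j F)]
  exact sum_le_sum fun A hA => (sum_shiftSet_le hij hA).1

lemma sum_shift_lt {i j : ℕ} (hij : i < j) {F : Finset (Finset ℕ)} (hF : shift i j F ≠ F) :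
    ∑ A ∈ shift i j F, ∑ x ∈ A, x < ∑ A ∈ F, ∑ x ∈ A, x := by
  have hA : ∃ A ∈ F, shiftSet i j F A ≠ A := by
    by_contra! h
    exact hF ((image_congr h).trans image_id')
  obtain ⟨A, hA, hne⟩ := hA
  rw [shift, sum_image (injOn_shiftSet i j F)]
  exact sum_lt_sum (fun A hA => (sum_shiftSet_le hij hA).1) ⟨A, hA, (sum_shiftSet_le hij hA).2 hne⟩

lemma shifted_of_shift_eq {Y : Finset ℕ} {F : Finset (Finset ℕ)}
    (h : ∀ i ∈ Y, ∀ j, i < j → shift i j F = F) : Shifted Y F := by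
  intro A hA j hj i hi hij hiA
  rw [← image_swap_eq_insert_erase hj hiA]
  by_contra hn
  rcases shiftSet_cases (i := i) (j := j) hA with ⟨-, h1⟩ | ⟨-, -, -, h1⟩
  · exact hn (h1 hj hiA)
  · apply hn
    have hmem : shiftSet i j F A ∈ shift i j F := mem_image_of_mem _ hA
    rwa [h i hi j hij, h1] at hmem

/-- Induction along the shifting process, applied simultaneously to finitely many families. -/
theorem shift_induction {ι : Type*} [Fintype ι] (Y : Finset ℕ)
    {P : (ι → Finset (Finset ℕ)) → Prop} (base : ∀ F, (∀ a, Shifted Y (F a)) → P F)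
    (step : ∀ F, ∀ i ∈ Y, ∀ j, i < j → P (fun a => shift i j (F a)) → P F)
    (F : ι → Finset (Finset ℕ)) : P F := by
  induction hw : ∑ a, ∑ A ∈ F a, ∑ x ∈ A, x using Nat.strong_induction_on generalizing F with
  | _ w ih =>
    subst hw
    by_cases h : ∀ i ∈ Y, ∀ j, i < j → ∀ a, shift i j (F a) = F a
    · exact base F fun a => shifted_of_shift_eq fun i hi j hij => h i hi j hij a
    · push Not at h
      obtain ⟨i, hi, j, hij, a, ha⟩ := h
      refine step F i hi j hij (ih _ ?_ _ rfl)
      exact sum_lt_sum (fun a _ => sum_shift_le hij (F a)) ⟨a, mem_univ _, sum_shift_lt hij ha⟩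

section Subfamilies

variable {a k : ℕ} {Y : Finset ℕ} {F : Finset (Finset ℕ)}

lemma mem_powersetCard_of_notMem {A : Finset ℕ} (hA : A ∈ powersetCard k (insert a Y))
    (ha : a ∉ A) : A ∈ powersetCard k Y := by
  rw [mem_powersetCard] at hA ⊢
  exact ⟨(subset_insert_iff_of_notMem ha).1 hA.1, hA.2⟩

lemma nonMemberSubfamily_subset_powersetCard (hF : F ⊆ powersetCard k (insert a Y)) :
    F.nonMemberSubfamily a ⊆ powersetCard k Y := by
  intro A hA
  rw [mem_nonMemberSubfamily] at hA
  exact mem_powersetCard_of_notMem (hF hA.1) hA.2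

lemma memberSubfamily_subset_powersetCard (hF : F ⊆ powersetCard k (insert a Y)) :
    F.memberSubfamily a ⊆ powersetCard (k - 1) Y := by
  intro A hA
  rw [mem_memberSubfamily] at hA
  have h := mem_powersetCard.1 (hF hA.1)
  rw [card_insert_of_notMem hA.2] at h
  rw [mem_powersetCard]
  exact ⟨(insert_subset_insert_iff hA.2).1 h.1, by omega⟩

lemma Shifted.nonMemberSubfamily (hF : Shifted (insert a Y) F) (ha : ∀ y ∈ Y, y < a) :
    Shifted Y (F.nonMemberSubfamily a) := by
  intro A hA j hj i hi hij hiA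
  rw [mem_nonMemberSubfamily] at hA ⊢
  refine ⟨hF A hA.1 j hj i (mem_insert_of_mem hi) hij hiA, ?_⟩
  have := ha i hi
  simp only [mem_insert, mem_erase, not_or, not_and]
  exact ⟨by omega, fun _ => hA.2⟩

lemma Shifted.memberSubfamily (hF : Shifted (insert a Y) F) (ha : ∀ y ∈ Y, y < a) :
    Shifted Y (F.memberSubfamily a) := by
  intro A hA j hj i hi hij hiA
  rw [mem_memberSubfamily] at hA ⊢
  have hia := ha i hi
  have hja : j ≠ a := fun h => hA.2 (h ▸ hj)
  have := hF _ hA.1 j (mem_insert_of_mem hj) i (mem_insert_of_mem hi) hij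
    (by simp only [mem_insert, not_or]; exact ⟨by omega, hiA⟩)
  rw [erase_insert_of_ne hja.symm, Finset.insert_comm] at this
  refine ⟨this, ?_⟩
  simp only [mem_insert, mem_erase, not_or, not_and]
  exact ⟨by omega, fun _ => hA.2⟩

lemma CrossDependent.mono {ι : Type*} {F G : ι → Finset (Finset ℕ)} (hG : CrossDependent G)
    (h : ∀ b, F b ⊆ G b) : CrossDependent F :=
  fun g hg => hG g fun b => h b (hg b)

/-- Deleting the largest element of the ground set from the members containing it keeps shifted
families cross-dependent, as long as the ground set is large. -/
lemma CrossDependent.memberSubfamily {ι : Type*} [Fintype ι] {F : ι → Finset (Finset ℕ)}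
    (hF : CrossDependent F) (hsub : ∀ b, F b ⊆ powersetCard k (insert a Y))
    (hs : ∀ b, Shifted (insert a Y) (F b)) (ha : ∀ y ∈ Y, y < a)
    (hk : Fintype.card ι * k ≤ (insert a Y).card) :
    CrossDependent (fun b => (F b).memberSubfamily a) := by
  classical
  intro g hg
  by_contra! hdis
  replace hg : ∀ b, insert a (g b) ∈ F b ∧ a ∉ g b := fun b => mem_memberSubfamily.1 (hg b)
  have hgY : ∀ b, g b ⊆ insert a Y ∧ (g b).card + 1 = k := by
    intro b
    have h := mem_powersetCard.1 (hsub b (hg b).1)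
    rw [card_insert_of_notMem (hg b).2] at h
    exact ⟨(subset_insert _ _).trans h.1, h.2⟩
  set U : Finset ℕ := univ.biUnion g with hU
  have hUY : U ⊆ insert a Y := biUnion_subset.2 fun b _ => (hgY b).1
  have hcard : Fintype.card ι ≤ (insert a Y \ U).card := by
    rw [card_sdiff_of_subset hUY]
    have h1 : U.card ≤ Fintype.card ι * (k - 1) := by
      refine (card_biUnion_le_card_mul _ _ (k - 1) fun b _ => ?_)
      have := (hgY b).2
      omega
    rcases Nat.eq_zero_or_pos k with rfl | hk0
    · rcases isEmpty_or_nonempty ι with h | ⟨⟨b⟩⟩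
      · simp
      · have := (hgY b).2
        omega
    · have h2 : Fintype.card ι * k = Fintype.card ι * (k - 1) + Fintype.card ι := by
        conv_lhs => rw [← Nat.sub_add_cancel hk0, Nat.mul_succ]
      omega
  obtain ⟨e⟩ : Nonempty (ι ↪ (insert a Y \ U : Finset ℕ)) :=
    Function.Embedding.nonempty_of_card_le (by simpa using hcard)
  have he : ∀ b c, (e b : ℕ) ∉ g c := fun b c h =>
    (mem_sdiff.1 (e b).2).2 (mem_biUnion.2 ⟨c, mem_univ _, h⟩)
  obtain ⟨b, c, hbc, h⟩ := hF (fun b => insert (e b : ℕ) (g b)) (by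
    intro b
    rcases mem_insert.1 (mem_sdiff.1 (e b).2).1 with h | h
    · simp only [h]; exact (hg b).1
    · have hlt := ha _ h
      have := hs b _ (hg b).1 a (mem_insert_self _ _) _ (mem_insert_of_mem h) hlt
        (by simp only [mem_insert, not_or]; exact ⟨by omega, he b b⟩)
      rwa [erase_insert (hg b).2] at this)
  apply h
  rw [disjoint_insert_left, disjoint_insert_right]
  refine ⟨?_, he c b, hdis b c hbc⟩
  rw [mem_insert, not_or]
  exact ⟨fun h => hbc (e.injective (Subtype.ext h)), he b c⟩

end Subfamilies

section Shadow

lemma card_mul_le_card_shadow_mul {k : ℕ} {Y : Finset ℕ} {F : Finset (Finset ℕ)}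
    (hF : F ⊆ powersetCard k Y) : F.card * k ≤ F.shadow.card * (Y.card - k + 1) := by
  refine card_mul_le_card_mul' (· ⊆ ·) (fun A hA => ?_) (fun B hB => ?_)
  · rw [← (mem_powersetCard.1 (hF hA)).2, ← card_image_of_injOn A.erase_injOn]
    refine card_le_card ?_
    simp_rw [image_subset_iff, mem_bipartiteBelow]
    exact fun x hx => ⟨erase_mem_shadow hA hx, erase_subset _ _⟩
  · obtain ⟨x, hx, hxB⟩ := mem_shadow_iff_insert_mem.1 hB
    have h := mem_powersetCard.1 (hF hxB)
    rw [card_insert_of_notMem hx] at h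
    have hBY : B ⊆ Y := (subset_insert _ _).trans h.1
    have hle : B.card + 1 ≤ Y.card := by
      rw [← card_insert_of_notMem hx]; exact card_le_card h.1
    calc _ ≤ ((Y \ B).image fun y => insert y B).card := by
          refine card_le_card fun A hA => ?_
          rw [mem_bipartiteAbove] at hA
          have hA' := mem_powersetCard.1 (hF hA.1)
          obtain ⟨y, hy, rfl⟩ := (covBy_iff_exists_insert.1
            (covBy_iff_card_sdiff_eq_one.2 ⟨hA.2, by rw [card_sdiff_of_subset hA.2]; omega⟩))
          exact mem_image.2 ⟨y, mem_sdiff.2 ⟨hA'.1 (mem_insert_self _ _), hy⟩, rfl⟩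
      _ ≤ (Y \ B).card := card_image_le
      _ ≤ _ := by rw [card_sdiff_of_subset hBY]; omega

/-- A shifted family without `s + 1` pairwise disjoint members is at most `s` times as large as its
shadow. -/
theorem card_le_mul_card_shadow (s : ℕ) (Y : Finset ℕ) : ∀ (k : ℕ) (F : Finset (Finset ℕ)),
    F ⊆ powersetCard k Y → Shifted Y F → CrossDependent (fun _ : Fin (s + 1) => F) →
    F.card ≤ s * F.shadow.card := by
  induction Y using Finset.induction_on_max with
  | empty =>
    intro k F hF hs hd
    rcases F.eq_empty_or_nonempty with rfl | ⟨A, hA⟩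
    · simp
    have hA0 : A = ∅ := subset_empty.1 (mem_powersetCard.1 (hF hA)).1
    obtain ⟨_, _, _, h⟩ := hd (fun _ => A) fun _ => hA
    exact absurd (by simp [hA0]) h
  | insert a Y ha ih =>
    intro k F hF hs hd
    have haY : a ∉ Y := fun h => (ha a h).false
    rcases Nat.eq_zero_or_pos k with rfl | hk
    · rcases F.eq_empty_or_nonempty with rfl | ⟨A, hA⟩
      · simp
      have hA0 : A = ∅ := card_eq_zero.1 (mem_powersetCard.1 (hF hA)).2
      obtain ⟨_, _, _, h⟩ := hd (fun _ => A) fun _ => hA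
      exact absurd (by simp [hA0]) h
    by_cases hY : (s + 1) * k ≤ (insert a Y).card
    · have h0 := ih k _ (nonMemberSubfamily_subset_powersetCard hF) (hs.nonMemberSubfamily ha)
        (hd.mono fun _ A hA => (mem_nonMemberSubfamily.1 hA).1)
      have h1 := ih (k - 1) _ (memberSubfamily_subset_powersetCard hF) (hs.memberSubfamily ha)
        (hd.memberSubfamily (fun _ => hF) (fun _ => hs) ha (by simpa using hY))
      have h2 : (F.nonMemberSubfamily a).shadow ⊆ F.shadow.nonMemberSubfamily a := by
        intro B hB
        obtain ⟨x, hx, hxB⟩ := mem_shadow_iff_insert_mem.1 hB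
        rw [mem_nonMemberSubfamily] at hxB ⊢
        exact ⟨mem_shadow_iff_insert_mem.2 ⟨x, hx, hxB.1⟩, fun h => hxB.2 (mem_insert_of_mem h)⟩
      have h3 : (F.memberSubfamily a).shadow ⊆ F.shadow.memberSubfamily a := by
        intro B hB
        obtain ⟨x, hx, hxB⟩ := mem_shadow_iff_insert_mem.1 hB
        rw [mem_memberSubfamily, mem_insert, not_or] at hxB
        rw [mem_memberSubfamily]
        refine ⟨mem_shadow_iff_insert_mem.2 ⟨x, ?_, ?_⟩, hxB.2.2⟩
        · rw [mem_insert, not_or]; exact ⟨fun h => hxB.2.1 h.symm, hx⟩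
        · rw [Finset.insert_comm]; exact hxB.1
      rw [← card_memberSubfamily_add_card_nonMemberSubfamily a F,
        ← card_memberSubfamily_add_card_nonMemberSubfamily a F.shadow, mul_add]
      have h4 := Nat.mul_le_mul_left s (card_le_card h2)
      have h5 := Nat.mul_le_mul_left s (card_le_card h3)
      omega
    · have h := card_mul_le_card_shadow_mul hF
      refine Nat.le_of_mul_le_mul_right ?_ hk
      rcases F.eq_empty_or_nonempty with rfl | ⟨A, hA⟩
      · simp
      have hA' := mem_powersetCard.1 (hF hA)
      have hkY := hA'.2 ▸ card_le_card hA'.1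
      calc F.card * k ≤ F.shadow.card * ((insert a Y).card - k + 1) := h
        _ ≤ F.shadow.card * (s * k) := by
          refine Nat.mul_le_mul_left _ ?_
          rw [add_mul, one_mul] at hY
          omega
        _ = s * F.shadow.card * k := by ring

end Shadow

section HiltonMilner

/-- Every member of `A` meets every member of `B`. -/
def CrossIntersecting (A B : Finset (Finset ℕ)) : Prop :=
  ∀ S ∈ A, ∀ T ∈ B, ¬ Disjoint S T

lemma CrossIntersecting.symm {A B : Finset (Finset ℕ)} (h : CrossIntersecting A B) :
    CrossIntersecting B A :=
  fun S hS T hT hST => h T hT S hS hST.symm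

lemma CrossIntersecting.mono {A A' B B' : Finset (Finset ℕ)} (h : CrossIntersecting A' B')
    (hA : A ⊆ A') (hB : B ⊆ B') : CrossIntersecting A B :=
  fun S hS T hT => h S (hA hS) T (hB hT)

lemma crossDependent_bool_iff {F : Bool → Finset (Finset ℕ)} :
    CrossDependent F ↔ CrossIntersecting (F true) (F false) := by
  constructor
  · intro h S hS T hT hST
    obtain ⟨a, b, hab, hn⟩ := h (fun b => cond b S T) (by simp [hS, hT])
    apply hn
    cases a <;> cases b <;> simp_all [disjoint_comm]
  · intro h g hg
    exact ⟨true, false, by simp, h _ (hg true) _ (hg false)⟩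

lemma CrossIntersecting.shift {A B : Finset (Finset ℕ)} (h : CrossIntersecting A B) (i j : ℕ) :
    CrossIntersecting (shift i j A) (shift i j B) := by
  have h' : CrossDependent (fun b : Bool => cond b A B) := crossDependent_bool_iff.2 h
  exact crossDependent_bool_iff.1 (h'.shift i j)

lemma CrossIntersecting.memberSubfamily {a k : ℕ} {Y : Finset ℕ} {A B : Finset (Finset ℕ)}
    (h : CrossIntersecting A B) (hA : A ⊆ powersetCard k (insert a Y))
    (hB : B ⊆ powersetCard k (insert a Y)) (hsA : Shifted (insert a Y) A)
    (hsB : Shifted (insert a Y) B) (ha : ∀ y ∈ Y, y < a) (hk : 2 * k ≤ (insert a Y).card) :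
    CrossIntersecting (A.memberSubfamily a) (B.memberSubfamily a) := by
  have h' : CrossDependent (fun b : Bool => cond b A B) := crossDependent_bool_iff.2 h
  exact crossDependent_bool_iff.1 (h'.memberSubfamily (k := k) (by simp [hA, hB])
    (by simp [hsA, hsB]) ha (by simpa using hk))

lemma nonMemberSubfamily_subset_self (a : ℕ) (F : Finset (Finset ℕ)) :
    F.nonMemberSubfamily a ⊆ F :=
  fun _ hA => (mem_nonMemberSubfamily.1 hA).1

/-- A family of `m`-sets, all meeting a fixed set `T`, misses the `m`-sets avoiding `T`. -/
lemma card_add_choose_le_of_forall_not_disjoint {m : ℕ} {Y T : Finset ℕ} {A : Finset (Finset ℕ)}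
    (hA : A ⊆ powersetCard m Y) (hT : T ⊆ Y) (h : ∀ S ∈ A, ¬ Disjoint S T) :
    A.card + (Y.card - T.card).choose m ≤ Y.card.choose m := by
  rw [← card_sdiff_of_subset hT, ← card_powersetCard, ← card_powersetCard,
    ← card_union_of_disjoint]
  · exact card_le_card (union_subset hA (powersetCard_mono sdiff_subset))
  · rw [disjoint_left]
    intro S hS hS'
    exact h S hS (disjoint_of_subset_left (mem_powersetCard.1 hS').1 sdiff_disjoint)

/-- Complementation in a `2 * k`-element set. -/
lemma CrossIntersecting.card_add_card_le {k : ℕ} {Y : Finset ℕ} {A B : Finset (Finset ℕ)}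
    (h : CrossIntersecting A B) (hA : A ⊆ powersetCard k Y) (hB : B ⊆ powersetCard k Y)
    (hY : Y.card = 2 * k) : A.card + B.card ≤ Y.card.choose k := by
  have hinj : Set.InjOn (fun S => Y \ S) (B : Set (Finset ℕ)) := by
    intro S hS T hT hST
    have hS' := (mem_powersetCard.1 (hB hS)).1
    have hT' := (mem_powersetCard.1 (hB hT)).1
    simp only at hST
    rw [← Finset.sdiff_sdiff_eq_self hS', hST, Finset.sdiff_sdiff_eq_self hT']
  rw [← card_image_of_injOn hinj, ← card_powersetCard, ← card_union_of_disjoint]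
  · refine card_le_card (union_subset hA fun S hS => ?_)
    obtain ⟨T, hT, rfl⟩ := mem_image.1 hS
    have hT' := mem_powersetCard.1 (hB hT)
    rw [mem_powersetCard, card_sdiff_of_subset hT'.1]
    exact ⟨sdiff_subset, by omega⟩
  · rw [disjoint_left]
    intro S hS hS'
    obtain ⟨T, hT, rfl⟩ := mem_image.1 hS'
    exact h _ hS T hT sdiff_disjoint

/-- A nonempty shifted family has members avoiding the largest element. -/
lemma Shifted.exists_mem_nonMemberSubfamily {a k : ℕ} {Y : Finset ℕ} {A : Finset (Finset ℕ)}
    (hs : Shifted (insert a Y) A) (hA : A ⊆ powersetCard k (insert a Y)) (ha : ∀ y ∈ Y, y < a)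
    (hk : k ≤ Y.card) {S : Finset ℕ} (hS : S ∈ A) :
    ∃ T ∈ A.nonMemberSubfamily a, T ∈ powersetCard k Y := by
  have hsub := nonMemberSubfamily_subset_powersetCard hA
  suffices ∃ T, T ∈ A.nonMemberSubfamily a from this.imp fun T hT => ⟨hT, hsub hT⟩
  by_cases haS : a ∈ S
  · have hS' := mem_powersetCard.1 (hA hS)
    obtain ⟨i, hi, hiS⟩ : ∃ i ∈ Y, i ∉ S.erase a := by
      apply exists_mem_notMem_of_card_lt_card
      have := card_erase_lt_of_mem haS
      omega
    have hia := ha i hi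
    refine ⟨insert i (S.erase a), mem_nonMemberSubfamily.2 ⟨hs S hS a haS i (mem_insert_of_mem hi)
      hia fun h => hiS (mem_erase.2 ⟨hia.ne, h⟩), ?_⟩⟩
    simp [hia.ne']
  · exact ⟨S, mem_nonMemberSubfamily.2 ⟨hS, haS⟩⟩

lemma choose_succ_of_pos (m : ℕ) {k : ℕ} (hk : 0 < k) :
    (m + 1).choose k = m.choose (k - 1) + m.choose k := by
  obtain ⟨k, rfl⟩ := Nat.exists_eq_add_of_lt hk
  simp [Nat.choose_succ_succ]

theorem CrossIntersecting.card_add_card_le_of_shifted (Y : Finset ℕ) :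
    ∀ (k : ℕ) (A B : Finset (Finset ℕ)), A ⊆ powersetCard k Y → B ⊆ powersetCard k Y →
    Shifted Y A → Shifted Y B → A.Nonempty → B.Nonempty → CrossIntersecting A B →
    2 * k ≤ Y.card → A.card + B.card + (Y.card - k).choose k ≤ Y.card.choose k + 1 := by
  induction Y using Finset.induction_on_max with
  | empty =>
    intro k A B hA hB _ _ ⟨S, hS⟩ ⟨T, hT⟩ h _
    have hS0 : S = ∅ := subset_empty.1 (mem_powersetCard.1 (hA hS)).1
    exact absurd (by simp [hS0]) (h S hS T hT)
  | insert a Y ha ih =>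
    intro k A B hA hB hsA hsB hneA hneB h hk
    obtain ⟨S, hS⟩ := hneA
    obtain ⟨T, hT⟩ := hneB
    have haY : a ∉ Y := fun h => (ha a h).false
    have hk0 : 0 < k := by
      rw [Nat.pos_iff_ne_zero]
      rintro rfl
      have hS0 : S = ∅ := card_eq_zero.1 (mem_powersetCard.1 (hA hS)).2
      exact absurd (by simp [hS0]) (h S hS T hT)
    rcases hk.eq_or_lt with hk | hk
    · have := h.card_add_card_le hA hB hk.symm
      have hkk : (insert a Y).card - k = k := by omega
      rw [hkk, Nat.choose_self]
      omega
    rw [card_insert_of_notMem haY] at hk ⊢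
    have hA0 := nonMemberSubfamily_subset_powersetCard hA
    have hB0 := nonMemberSubfamily_subset_powersetCard hB
    have hA1 := memberSubfamily_subset_powersetCard hA
    have hB1 := memberSubfamily_subset_powersetCard hB
    obtain ⟨S0, hS0, hS0'⟩ := hsA.exists_mem_nonMemberSubfamily hA ha (by omega) hS
    obtain ⟨T0, hT0, hT0'⟩ := hsB.exists_mem_nonMemberSubfamily hB ha (by omega) hT
    have h0 := ih k _ _ hA0 hB0 (hsA.nonMemberSubfamily ha) (hsB.nonMemberSubfamily ha) ⟨S0, hS0⟩
      ⟨T0, hT0⟩ (h.mono (nonMemberSubfamily_subset_self a A) (nonMemberSubfamily_subset_self a B))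
      (by omega)
    have h1 := h.memberSubfamily hA hB hsA hsB ha (by rw [card_insert_of_notMem haY]; omega)
    have hcA := card_memberSubfamily_add_card_nonMemberSubfamily a A
    have hcB := card_memberSubfamily_add_card_nonMemberSubfamily a B
    have hp1 := choose_succ_of_pos Y.card hk0
    have hp2 := choose_succ_of_pos (Y.card - k) hk0
    have hsub1 : Y.card + 1 - k = Y.card - k + 1 := by omega
    rw [hsub1, hp1, hp2]
    have hhit : ∀ {C D : Finset (Finset ℕ)} {V : Finset ℕ}, CrossIntersecting C D →
        C ⊆ powersetCard k (insert a Y) →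
        V ∈ D.nonMemberSubfamily a → V ∈ powersetCard k Y →
        (C.memberSubfamily a).card + (Y.card - k).choose (k - 1) ≤ Y.card.choose (k - 1) := by
      intro C D V hCD hC hV hV'
      rw [mem_powersetCard] at hV'
      rw [mem_nonMemberSubfamily] at hV
      rw [← hV'.2]
      refine card_add_choose_le_of_forall_not_disjoint
        (hV'.2 ▸ memberSubfamily_subset_powersetCard hC) hV'.1 fun W hW hd => ?_
      rw [mem_memberSubfamily] at hW
      exact hCD _ hW.1 V hV.1 (disjoint_insert_left.2 ⟨hV.2, hd⟩)
    rcases (A.memberSubfamily a).eq_empty_or_nonempty with hAe | ⟨S1, hS1⟩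
    · have := hhit h.symm hB hS0 hS0'
      rw [hAe, card_empty] at hcA
      omega
    rcases (B.memberSubfamily a).eq_empty_or_nonempty with hBe | ⟨T1, hT1⟩
    · have := hhit h hA hT0 hT0'
      rw [hBe, card_empty] at hcB
      omega
    have hk1 : 0 < k - 1 := by
      rw [Nat.pos_iff_ne_zero]
      intro hk1
      have hS0 : S1 = ∅ := card_eq_zero.1 ((mem_powersetCard.1 (hA1 hS1)).2.trans hk1)
      exact absurd (by simp [hS0]) (h1 S1 hS1 T1 hT1)
    have h2 := ih (k - 1) _ _ hA1 hB1 (hsA.memberSubfamily ha) (hsB.memberSubfamily ha) ⟨S1, hS1⟩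
      ⟨T1, hT1⟩ h1 (by omega)
    have hp3 := choose_succ_of_pos (Y.card - k) hk1
    have hsub2 : Y.card - (k - 1) = Y.card - k + 1 := by omega
    have hpos : 0 < (Y.card - k).choose (k - 1 - 1) := Nat.choose_pos (by omega)
    rw [hsub2, hp3] at h2
    omega

/-- Two nonempty cross-intersecting families of `k`-subsets of a set with at least `2 * k`
elements are together not larger than in the extremal example consisting of one `k`-set and all
`k`-sets meeting it. -/
theorem CrossIntersecting.card_add_card_add_choose_le {k : ℕ} {Y : Finset ℕ}
    {A B : Finset (Finset ℕ)} (h : CrossIntersecting A B) (hA : A ⊆ powersetCard k Y)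
    (hB : B ⊆ powersetCard k Y) (hneA : A.Nonempty) (hneB : B.Nonempty) (hk : 2 * k ≤ Y.card) :
    A.card + B.card + (Y.card - k).choose k ≤ Y.card.choose k + 1 := by
  have key := shift_induction (ι := Bool) Y (P := fun F => (∀ b, F b ⊆ powersetCard k Y) →
    (∀ b, (F b).Nonempty) → CrossIntersecting (F true) (F false) →
    (F true).card + (F false).card + (Y.card - k).choose k ≤ Y.card.choose k + 1)
    (fun F hs hF hne hd => CrossIntersecting.card_add_card_le_of_shifted Y k _ _ (hF _) (hF _)
      (hs _) (hs _) (hne _) (hne _) hd hk)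
    (fun F i hi j _ ih hF hne hd => by
      have := ih (fun b => shift_subset_powersetCard hi (hF b)) (fun b => (hne b).image _)
        (hd.shift i j)
      simpa only [card_shift] using this)
    (fun b => cond b A B)
  exact key (by simp [hA, hB]) (by simp [hneA, hneB]) h

lemma one_lt_of_intersecting_of_nontrivial {k : ℕ} {Y : Finset ℕ} {F : Finset (Finset ℕ)}
    (hF : F ⊆ powersetCard k Y) (hd : CrossIntersecting F F) (hn : ∀ x, ∃ A ∈ F, x ∉ A) :
    1 < k := by
  obtain ⟨A, hA, -⟩ := hn 0
  by_contra hk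
  have hcard := (mem_powersetCard.1 (hF hA)).2
  rcases A.eq_empty_or_nonempty with hA0 | ⟨x, hx⟩
  · exact hd A hA A hA (by simp [hA0])
  obtain ⟨B, hB, hxB⟩ := hn x
  refine hd A hA B hB ?_
  have hAx : A = {x} := by
    refine (eq_of_subset_of_card_le (singleton_subset_iff.2 hx) ?_).symm
    rw [card_singleton]
    omega
  rw [hAx, disjoint_singleton_left]
  exact hxB

theorem hilton_milner_of_shifted (Y : Finset ℕ) : ∀ (k : ℕ) (F : Finset (Finset ℕ)),
    F ⊆ powersetCard k Y → Shifted Y F → CrossIntersecting F F → (∀ x, ∃ A ∈ F, x ∉ A) →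
    2 * k ≤ Y.card →
    F.card + (Y.card - 1 - k).choose (k - 1) ≤ (Y.card - 1).choose (k - 1) + 1 := by
  induction Y using Finset.induction_on_max with
  | empty =>
    intro k F hF _ hd hn hk
    have := one_lt_of_intersecting_of_nontrivial hF hd hn
    rw [card_empty] at hk
    omega
  | insert a Y ha ih =>
    intro k F hF hs hd hn hk
    have hk1 := one_lt_of_intersecting_of_nontrivial hF hd hn
    have haY : a ∉ Y := fun h => (ha a h).false
    rcases hk.eq_or_lt with hk | hk
    · have h := hd.card_add_card_le hF hF hk.symm
      have h1 := choose_succ_of_pos (2 * k - 1) (k := k) (by omega)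
      have h2 : (2 * k - 1).choose (k - 1) = (2 * k - 1).choose k := by
        apply Nat.choose_symm_of_eq_add; omega
      have h3 : 2 * k - 1 + 1 = 2 * k := by omega
      have h4 : 2 * k - 1 - k = k - 1 := by omega
      rw [h3] at h1
      rw [← hk] at h ⊢
      rw [h4, Nat.choose_self]
      omega
    rw [card_insert_of_notMem haY] at hk ⊢
    have hF0 := nonMemberSubfamily_subset_powersetCard hF
    have hF1 := memberSubfamily_subset_powersetCard hF
    have hd1 := hd.memberSubfamily hF hF hs hs ha (by rw [card_insert_of_notMem haY]; omega)
    have hn0 : ∀ x, ∃ A ∈ F.nonMemberSubfamily a, x ∉ A := by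
      intro x
      obtain ⟨A, hA, hxA⟩ := hn x
      by_cases haA : a ∈ A
      · have hA' := mem_powersetCard.1 (hF hA)
        obtain ⟨i, hi, hiA⟩ : ∃ i ∈ Y, i ∉ insert x (A.erase a) := by
          apply exists_mem_notMem_of_card_lt_card
          have h1 := card_erase_add_one haA
          have h2 := card_insert_le x (A.erase a)
          omega
        rw [mem_insert, not_or] at hiA
        have hia := ha i hi
        refine ⟨insert i (A.erase a), mem_nonMemberSubfamily.2 ⟨hs A hA a haA i
          (mem_insert_of_mem hi) hia fun h => hiA.2 (mem_erase.2 ⟨hia.ne, h⟩), ?_⟩, ?_⟩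
        · simp [hia.ne']
        · simp only [mem_insert, mem_erase, not_or, not_and]
          exact ⟨fun h => hiA.1 h.symm, fun _ => hxA⟩
      · exact ⟨A, mem_nonMemberSubfamily.2 ⟨hA, haA⟩, hxA⟩
    have h0 := ih k _ hF0 (hs.nonMemberSubfamily ha)
      (hd.mono (nonMemberSubfamily_subset_self a F) (nonMemberSubfamily_subset_self a F)) hn0
      (by omega)
    have hc := card_memberSubfamily_add_card_nonMemberSubfamily a F
    have hsub1 : Y.card + 1 - 1 = Y.card - 1 + 1 := by omega
    have hsub2 : Y.card - 1 + 1 - k = Y.card - 1 - k + 1 := by omega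
    rw [hsub1, hsub2, choose_succ_of_pos _ (by omega : 0 < k - 1),
      choose_succ_of_pos _ (by omega : 0 < k - 1)]
    by_cases hn1 : ∀ x, ∃ A ∈ F.memberSubfamily a, x ∉ A
    · have hk2 := one_lt_of_intersecting_of_nontrivial hF1 hd1 hn1
      have h1 := ih (k - 1) _ hF1 (hs.memberSubfamily ha) hd1 hn1 (by omega)
      have hsub3 : Y.card - 1 - (k - 1) = Y.card - 1 - k + 1 := by omega
      have hpos : 0 < (Y.card - 1 - k).choose (k - 1 - 1 - 1) := Nat.choose_pos (by omega)
      rw [hsub3, choose_succ_of_pos _ (by omega : 0 < k - 1 - 1)] at h1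
      omega
    · push Not at hn1
      obtain ⟨x, hx⟩ := hn1
      have h1 : (F.memberSubfamily a).card + (Y.card - 1 - k).choose (k - 1 - 1) ≤
          (Y.card - 1).choose (k - 1 - 1) := by
        rcases (F.memberSubfamily a).eq_empty_or_nonempty with he | ⟨A, hA⟩
        · rw [he, card_empty, zero_add]
          exact Nat.choose_le_choose _ (by omega)
        have hxY : x ∈ Y := (mem_powersetCard.1 (hF1 hA)).1 (hx A hA)
        obtain ⟨T, hT, hxT⟩ := hn0 x
        have hT' := mem_powersetCard.1 (hF0 hT)
        rw [mem_nonMemberSubfamily] at hT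
        have hinj : Set.InjOn (fun S : Finset ℕ => S.erase x)
            (F.memberSubfamily a : Set (Finset ℕ)) := by
          intro S hS S' hS' h
          simp only at h
          rw [← insert_erase (hx S hS), h, insert_erase (hx S' hS')]
        rw [← card_image_of_injOn hinj, ← card_erase_of_mem hxY, ← hT'.2]
        refine card_add_choose_le_of_forall_not_disjoint ?_
          (subset_erase.2 ⟨hT'.1, hxT⟩) ?_
        · intro S hS
          obtain ⟨R, hR, rfl⟩ := mem_image.1 hS
          have hR' := mem_powersetCard.1 (hF1 hR)
          rw [mem_powersetCard, card_erase_of_mem (hx R hR), hT'.2, hR'.2]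
          exact ⟨erase_subset_erase _ hR'.1, rfl⟩
        · intro S hS hST
          obtain ⟨R, hR, rfl⟩ := mem_image.1 hS
          refine hd _ (mem_memberSubfamily.1 hR).1 T hT.1 (disjoint_insert_left.2 ⟨hT.2, ?_⟩)
          rw [← insert_erase (hx R hR)]
          exact disjoint_insert_left.2 ⟨hxT, hST⟩
      omega

/-- The Hilton-Milner bound for a family all of whose members meet a fixed pair. -/
lemma hilton_milner_of_pair {k i j : ℕ} {Y : Finset ℕ} {F : Finset (Finset ℕ)}
    (hF : F ⊆ powersetCard k Y) (hd : CrossIntersecting F F) (hn : ∀ x, ∃ A ∈ F, x ∉ A)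
    (hk : 2 * k ≤ Y.card) (hij : i ≠ j) (hmeet : ∀ A ∈ F, i ∈ A ∨ j ∈ A) :
    F.card + (Y.card - 1 - k).choose (k - 1) ≤ (Y.card - 1).choose (k - 1) + 1 := by
  have hk1 := one_lt_of_intersecting_of_nontrivial hF hd hn
  obtain ⟨Ai, hAi, hiAi⟩ := hn i
  obtain ⟨Aj, hAj, hjAj⟩ := hn j
  have hjAi := (hmeet Ai hAi).resolve_left hiAi
  have hiAj := (hmeet Aj hAj).resolve_right hjAj
  have hjY : j ∈ Y := (mem_powersetCard.1 (hF hAi)).1 hjAi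
  have hiY : i ∈ Y := (mem_powersetCard.1 (hF hAj)).1 hiAj
  set Z := (Y.erase i).erase j with hZ
  have hjZ : j ∉ Z := notMem_erase _ _
  have hiZ : i ∉ insert j Z := by simp [hZ, hij]
  have hYZ : insert i (insert j Z) = Y := by
    rw [hZ, insert_erase (mem_erase.2 ⟨hij.symm, hjY⟩), insert_erase hiY]
  have hZc : Y.card = Z.card + 2 := by
    rw [← hYZ, card_insert_of_notMem hiZ, card_insert_of_notMem hjZ]
  rw [← hYZ] at hF
  have hM := memberSubfamily_subset_powersetCard hF
  have hN := nonMemberSubfamily_subset_powersetCard hF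
  have hMM := memberSubfamily_subset_powersetCard hM
  have hMN := nonMemberSubfamily_subset_powersetCard hM
  have hNM := memberSubfamily_subset_powersetCard hN
  have hNN : (F.nonMemberSubfamily i).nonMemberSubfamily j = ∅ := by
    refine eq_empty_of_forall_notMem fun A hA => ?_
    simp only [mem_nonMemberSubfamily] at hA
    rcases hmeet A hA.1.1 with h | h
    · exact hA.1.2 h
    · exact hA.2 h
  have hcross : CrossIntersecting ((F.memberSubfamily i).nonMemberSubfamily j)
      ((F.nonMemberSubfamily i).memberSubfamily j) := by
    intro S hS T hT hST
    rw [mem_nonMemberSubfamily, mem_memberSubfamily] at hS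
    rw [mem_memberSubfamily, mem_nonMemberSubfamily, mem_insert, not_or] at hT
    refine hd _ hS.1.1 _ hT.1.1 ?_
    rw [disjoint_insert_left, disjoint_insert_right, mem_insert, not_or]
    exact ⟨hT.1.2, hS.2, hST⟩
  have h1 := hcross.card_add_card_add_choose_le hMN hNM
    ⟨Aj.erase i, by simp [hiAj, hAj, hjAj]⟩
    ⟨Ai.erase j, by simp [hjAi, hAi, hiAi]⟩ (by omega)
  have h2 := card_le_card hMM
  rw [card_powersetCard] at h2
  have hc := card_memberSubfamily_add_card_nonMemberSubfamily i F
  have hcM := card_memberSubfamily_add_card_nonMemberSubfamily j (F.memberSubfamily i)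
  have hcN := card_memberSubfamily_add_card_nonMemberSubfamily j (F.nonMemberSubfamily i)
  rw [hNN, card_empty] at hcN
  have hsub1 : Y.card - 1 = Z.card + 1 := by omega
  have hsub2 : Z.card + 1 - k = Z.card - (k - 1) := by omega
  rw [hsub1, hsub2, choose_succ_of_pos _ (by omega : 0 < k - 1)]
  omega

/-- **Hilton-Milner theorem** for `2 * k ≤ Y.card`. -/
theorem hilton_milner {k : ℕ} {Y : Finset ℕ} {F : Finset (Finset ℕ)}
    (hF : F ⊆ powersetCard k Y) (hd : CrossIntersecting F F) (hn : ∀ x, ∃ A ∈ F, x ∉ A)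
    (hk : 2 * k ≤ Y.card) :
    F.card + (Y.card - 1 - k).choose (k - 1) ≤ (Y.card - 1).choose (k - 1) + 1 := by
  have key := shift_induction (ι := Unit) Y (P := fun F => F () ⊆ powersetCard k Y →
    CrossIntersecting (F ()) (F ()) → (∀ x, ∃ A ∈ F (), x ∉ A) →
    (F ()).card + (Y.card - 1 - k).choose (k - 1) ≤ (Y.card - 1).choose (k - 1) + 1)
    (fun F hs hF hd hn => hilton_milner_of_shifted Y k _ hF (hs _) hd hn hk)
    (fun F i hi j hij ih hF hd hn => by
      by_cases hn' : ∀ x, ∃ A ∈ shift i j (F ()), x ∉ A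
      · have := ih (shift_subset_powersetCard hi hF) (hd.shift i j) hn'
        simpa only [card_shift] using this
      push Not at hn'
      obtain ⟨z, hz⟩ := hn'
      obtain ⟨B, hB, hzB⟩ := hn z
      have hcases : ∀ A ∈ F (), z ∈ A ∨ (j ∈ A ∧ z ∈ insert i (A.erase j)) := by
        intro A hA
        have hzA := hz _ (mem_image_of_mem (shiftSet i j (F ())) hA)
        rcases shiftSet_cases (i := i) (j := j) hA with ⟨h, -⟩ | ⟨hj, hi', -, h⟩
        · left; rwa [h] at hzA
        · right
          rw [h, image_swap_eq_insert_erase hj hi'] at hzA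
          exact ⟨hj, hzA⟩
      have hzi : z = i := by
        rcases hcases B hB with h | ⟨-, h⟩
        · exact absurd h hzB
        · rcases mem_insert.1 h with h | h
          · exact h
          · exact absurd (mem_of_mem_erase h) hzB
      subst hzi
      exact hilton_milner_of_pair hF hd hn hk hij.ne fun A hA => (hcases A hA).imp_right And.left)
    (fun _ => F)
  exact key hF hd hn

end HiltonMilner

section Frankl

/-- Nested subsets of a `2 * s + 1`-set without a system of distinct representatives are small. -/
lemma sum_card_add_mul_card_le_of_no_transversal {s : ℕ}
    (J : Fin (s + 1) → Finset (Fin (2 * s + 1))) (hJ : Antitone J)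
    (hno : ¬ ∃ e : Fin (s + 1) → Fin (2 * s + 1), Function.Injective e ∧ ∀ i, e i ∈ J i) :
    ∑ i, (J i).card + s * (J (Fin.last s)).card ≤ s * (2 * s + 1) := by
  rw [← all_card_le_biUnion_card_iff_exists_injective] at hno
  push Not at hno
  obtain ⟨I, hI⟩ := hno
  have hne : I.Nonempty := card_pos.1 (by omega)
  set m := I.min' hne with hm
  have h1 : (J m).card ≤ (I.biUnion J).card :=
    card_le_card (subset_biUnion_of_mem J (I.min'_mem hne))
  have h2 : I.card ≤ s + 1 - m := by
    rw [← Fin.card_Ici]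
    exact card_le_card fun i hi => mem_Ici.2 (I.min'_le i hi)
  have hms : (m : ℕ) ≤ s := Nat.lt_succ_iff.1 m.2
  obtain ⟨q, hq⟩ := Nat.exists_eq_add_of_le hms
  have hle : ∀ i, m ≤ i → (J i).card ≤ q := fun i hi => by
    have := card_le_card (hJ hi)
    omega
  have h3 : ∑ i ∈ Iio m, (J i).card ≤ m * (2 * s + 1) := by
    have := sum_le_card_nsmul (Iio m) (fun i => (J i).card) (2 * s + 1)
      fun i _ => (card_le_univ _).trans (by simp)
    simpa using this
  have h4 : ∑ i ∈ Ici m, (J i).card ≤ (q + 1) * q := by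
    have := sum_le_card_nsmul (Ici m) (fun i => (J i).card) q fun i hi => hle i (mem_Ici.1 hi)
    rw [Fin.card_Ici, smul_eq_mul] at this
    have hqm : s + 1 - m = q + 1 := by omega
    rwa [hqm] at this
  have h5 : ∑ i, (J i).card = ∑ i ∈ Iio m, (J i).card + ∑ i ∈ Ici m, (J i).card := by
    rw [← sum_union]
    · refine sum_congr ?_ fun _ _ => rfl
      ext i
      simp [lt_or_ge]
    · rw [disjoint_left]
      intro i hi hi'
      rw [mem_Iio] at hi
      rw [mem_Ici] at hi'
      exact absurd hi' (not_le.2 hi)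
  have h6 := Nat.mul_le_mul_left s (hle _ (Fin.le_last m))
  rw [h5]
  generalize (m : ℕ) = p at *
  subst hq
  nlinarith

lemma exists_perm_image_eq {l : ℕ} {Z A B : Finset ℕ} (hA : A ∈ powersetCard l Z)
    (hB : B ∈ powersetCard l Z) : ∃ π : Perm ℕ, A.image π = B ∧ Z.image π = Z := by
  rw [mem_powersetCard] at hA hB
  obtain ⟨σ, hσ⟩ := Perm.exists_map_finset_eq (A.subtype (· ∈ Z)) (B.subtype (· ∈ Z)) (by
    rw [card_subtype, card_subtype, filter_true_of_mem fun x hx => hA.1 hx,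
      filter_true_of_mem fun x hx => hB.1 hx, hA.2, hB.2])
  have hπ : ∀ x (hx : x ∈ Z), Perm.ofSubtype σ x = σ ⟨x, hx⟩ := fun x hx =>
    Perm.ofSubtype_apply_of_mem σ hx
  refine ⟨Perm.ofSubtype σ, eq_of_subset_of_card_le ?_ ?_, eq_of_subset_of_card_le ?_ ?_⟩
  · intro y hy
    obtain ⟨x, hx, rfl⟩ := mem_image.1 hy
    have : σ ⟨x, hA.1 hx⟩ ∈ B.subtype (· ∈ Z) := by
      rw [← hσ]; exact mem_map.2 ⟨_, mem_subtype.2 hx, rfl⟩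
    rw [hπ x (hA.1 hx)]
    exact mem_subtype.1 this
  · rw [card_image_of_injective _ (Equiv.injective _), hA.2, hB.2]
  · intro y hy
    obtain ⟨x, hx, rfl⟩ := mem_image.1 hy
    rw [hπ x hx]
    exact (σ ⟨x, hx⟩).2
  · rw [card_image_of_injective _ (Equiv.injective _)]

/-- The sequences of `t` pairwise disjoint `l`-subsets of `Z`. -/
def disjointTuples (t l : ℕ) (Z : Finset ℕ) : Finset (Fin t → Finset ℕ) :=
  (Fintype.piFinset fun _ => powersetCard l Z).filter
    fun B => ∀ a b, a ≠ b → Disjoint (B a) (B b)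

lemma mem_disjointTuples {t l : ℕ} {Z : Finset ℕ} {B : Fin t → Finset ℕ} :
    B ∈ disjointTuples t l Z ↔
      (∀ a, B a ∈ powersetCard l Z) ∧ ∀ a b, a ≠ b → Disjoint (B a) (B b) := by
  rw [disjointTuples, mem_filter, Fintype.mem_piFinset]

lemma disjointTuples_nonempty {t l : ℕ} {Z : Finset ℕ} (h : t * l ≤ Z.card) :
    (disjointTuples t l Z).Nonempty := by
  obtain ⟨e⟩ : Nonempty (Fin t × Fin l ↪ Z) :=
    Function.Embedding.nonempty_of_card_le (by simpa using h)
  refine ⟨fun a => univ.image fun b => (e (a, b) : ℕ), mem_disjointTuples.2 ⟨fun a => ?_, ?_⟩⟩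
  · rw [mem_powersetCard, card_image_of_injective]
    · refine ⟨fun x hx => ?_, by simp⟩
      obtain ⟨b, -, rfl⟩ := mem_image.1 hx
      exact (e (a, b)).2
    · intro b c hbc
      exact congrArg Prod.snd (e.injective (Subtype.ext hbc))
  · intro a b hab
    rw [disjoint_left]
    intro x hx hx'
    obtain ⟨c, -, rfl⟩ := mem_image.1 hx
    obtain ⟨d, -, hd⟩ := mem_image.1 hx'
    exact hab (congrArg Prod.fst (e.injective (Subtype.ext hd))).symm

lemma image_mem_disjointTuples {t l : ℕ} {Z : Finset ℕ} {B : Fin t → Finset ℕ} {π : Perm ℕ}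
    (hπ : Z.image π = Z) (hB : B ∈ disjointTuples t l Z) :
    (fun a => (B a).image π) ∈ disjointTuples t l Z := by
  rw [mem_disjointTuples] at hB ⊢
  refine ⟨fun a => ?_, fun a b hab => (disjoint_image π.injective).2 (hB.2 a b hab)⟩
  have := mem_powersetCard.1 (hB.1 a)
  rw [mem_powersetCard, card_image_of_injective _ π.injective]
  exact ⟨hπ ▸ image_subset_image this.1, this.2⟩

/-- Each `l`-subset of `Z` occurs equally often in the tuples of disjoint `l`-subsets. -/
lemma sum_card_filter_eq_of_mem {t l : ℕ} {Z A A' : Finset ℕ} (hA : A ∈ powersetCard l Z)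
    (hA' : A' ∈ powersetCard l Z) :
    ∑ B ∈ disjointTuples t l Z, (univ.filter fun j => B j = A).card =
      ∑ B ∈ disjointTuples t l Z, (univ.filter fun j => B j = A').card := by
  obtain ⟨π, hπA, hπZ⟩ := exists_perm_image_eq hA hA'
  have hπZ' : Z.image π.symm = Z := by
    conv_lhs => rw [← hπZ, image_image]
    simp
  refine sum_nbij' (fun B a => (B a).image π) (fun B a => (B a).image π.symm)
    (fun B hB => image_mem_disjointTuples hπZ hB) (fun B hB => image_mem_disjointTuples hπZ' hB)
    (fun B _ => ?_) (fun B _ => ?_) (fun B _ => ?_)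
  · ext; simp
  · ext; simp
  · congr 1
    ext j
    simp only [mem_filter, mem_univ, true_and, ← hπA]
    exact (image_injective π.injective).eq_iff.symm

lemma sum_card_filter_mem {t l : ℕ} {Z A : Finset ℕ} {H : Finset (Finset ℕ)}
    (hA : A ∈ powersetCard l Z) (hH : H ⊆ powersetCard l Z) :
    ∑ B ∈ disjointTuples t l Z, (univ.filter fun j => B j ∈ H).card =
      H.card * ∑ B ∈ disjointTuples t l Z, (univ.filter fun j => B j = A).card := by
  have h : ∀ B : Fin t → Finset ℕ, (univ.filter fun j => B j ∈ H).card =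
      ∑ A' ∈ H, (univ.filter fun j => B j = A').card := by
    intro B
    rw [card_eq_sum_card_fiberwise (f := B) (t := H) (by intro j; simp)]
    refine sum_congr rfl fun A' hA' => ?_
    congr 1
    ext j
    simp only [mem_filter, mem_univ, true_and, and_iff_right_iff_imp]
    rintro rfl
    exact hA'
  simp_rw [h]
  rw [sum_comm, ← smul_eq_mul, ← sum_const]
  exact sum_congr rfl fun A' hA' => sum_card_filter_eq_of_mem (hH hA') hA

/-- Frankl's inequality for nested cross-dependent families, by averaging over tuples of disjoint
sets. -/
theorem CrossDependent.sum_card_add_mul_card_le {s l : ℕ} {Z : Finset ℕ}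
    {G : Fin (s + 1) → Finset (Finset ℕ)} (hd : CrossDependent G) (hG : Antitone G)
    (hsub : ∀ i, G i ⊆ powersetCard l Z) (hZ : (2 * s + 1) * l ≤ Z.card) :
    ∑ i, (G i).card + s * (G (Fin.last s)).card ≤ s * Z.card.choose l := by
  obtain ⟨B₀, hB₀⟩ := disjointTuples_nonempty hZ
  have hA := (mem_disjointTuples.1 hB₀).1 0
  set Ω := disjointTuples (2 * s + 1) l Z with hΩ
  set c := ∑ B ∈ Ω, (univ.filter fun j => B j = B₀ 0).card with hc
  have htotal : (2 * s + 1) * Ω.card = Z.card.choose l * c := by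
    rw [← card_powersetCard, hc, ← sum_card_filter_mem hA Subset.rfl, ← hΩ, mul_comm,
      ← smul_eq_mul, ← sum_const]
    refine sum_congr rfl fun B hB => ?_
    rw [filter_true_of_mem fun j _ => (mem_disjointTuples.1 hB).1 j]
    simp
  have hcpos : 0 < c := by
    have : 0 < (2 * s + 1) * Ω.card := Nat.mul_pos (by omega) (card_pos.2 ⟨B₀, hB₀⟩)
    rw [htotal] at this
    exact Nat.pos_of_mul_pos_left this
  have hB : ∀ B ∈ Ω, ∑ i, (univ.filter fun j => B j ∈ G i).card +
      s * (univ.filter fun j => B j ∈ G (Fin.last s)).card ≤ s * (2 * s + 1) := by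
    intro B hB
    refine sum_card_add_mul_card_le_of_no_transversal (fun i => univ.filter fun j => B j ∈ G i)
      (fun i i' h j hj => ?_) ?_
    · simp only [mem_filter, mem_univ, true_and] at hj ⊢
      exact hG h hj
    · rintro ⟨e, he, hmem⟩
      obtain ⟨a, b, hab, h⟩ := hd (fun i => B (e i)) fun i => (mem_filter.1 (hmem i)).2
      exact h ((mem_disjointTuples.1 hB).2 _ _ (he.ne hab))
  have hsum := sum_le_sum hB
  rw [sum_add_distrib, sum_comm, ← mul_sum, sum_const, smul_eq_mul] at hsum
  have hG' : ∀ i, ∑ B ∈ Ω, (univ.filter fun j => B j ∈ G i).card = (G i).card * c :=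
    fun i => sum_card_filter_mem hA (hsub i)
  rw [sum_congr rfl fun i _ => hG' i, hG', ← sum_mul] at hsum
  refine Nat.le_of_mul_le_mul_right ?_ hcpos
  calc _ = (∑ i, (G i).card) * c + s * ((G (Fin.last s)).card * c) := by ring
    _ ≤ Ω.card * (s * (2 * s + 1)) := hsum
    _ = s * ((2 * s + 1) * Ω.card) := by ring
    _ = s * Z.card.choose l * c := by rw [htotal]; ring

lemma exists_initial_segment {s : ℕ} {Y : Finset ℕ} (h : s + 1 ≤ Y.card) :
    ∃ σ : Fin (s + 1) → ℕ, StrictMono σ ∧ (∀ i, σ i ∈ Y) ∧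
      ∀ y ∈ Y, y ∉ univ.image σ → σ (Fin.last s) < y := by
  let o := Y.orderEmbOfFin rfl
  refine ⟨fun i => o (Fin.castLE h i), fun i j hij => o.strictMono hij,
    fun i => orderEmbOfFin_mem _ _ _, fun y hy hyn => ?_⟩
  obtain ⟨m, rfl⟩ : y ∈ Set.range o := by
    rw [range_orderEmbOfFin]; exact hy
  apply o.strictMono
  rw [Fin.lt_def]
  by_contra hm
  have hm' : (m : ℕ) < s + 1 := by
    simp only [Fin.val_castLE, Fin.val_last, not_lt] at hm
    omega
  exact hyn (mem_image.2 ⟨⟨m, hm'⟩, mem_univ _, rfl⟩)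

theorem erdos_matching_of_shifted {s k : ℕ} {Y : Finset ℕ} {F : Finset (Finset ℕ)}
    (hF : F ⊆ powersetCard k Y) (hs : Shifted Y F)
    (hd : CrossDependent (fun _ : Fin (s + 1) => F)) (hY : (2 * s + 1) * k ≤ Y.card + s) :
    F.card + (Y.card - s).choose k ≤ Y.card.choose k := by
  rcases Nat.eq_zero_or_pos k with rfl | hk
  · rcases F.eq_empty_or_nonempty with rfl | ⟨A, hA⟩
    · simp
    have hA0 : A = ∅ := card_eq_zero.1 (mem_powersetCard.1 (hF hA)).2
    obtain ⟨_, _, _, h⟩ := hd (fun _ => A) fun _ => hA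
    exact absurd (by simp [hA0]) h
  have hk' : (2 * s + 1) * k = (2 * s + 1) * (k - 1) + (2 * s + 1) := by
    conv_lhs => rw [← Nat.sub_add_cancel hk, Nat.mul_succ]
  obtain ⟨σ, hσ, hσY, hlast⟩ := exists_initial_segment (s := s) (Y := Y) (by omega)
  set Z := Y \ univ.image σ with hZdef
  have hσZ : ∀ i, σ i ∉ Z := fun i h => (mem_sdiff.1 h).2 (mem_image_of_mem _ (mem_univ _))
  have hZY : Z ⊆ Y := sdiff_subset
  have hZ : Z.card + (s + 1) = Y.card := by
    have h1 : univ.image σ ⊆ Y := fun x hx => by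
      obtain ⟨i, -, rfl⟩ := mem_image.1 hx
      exact hσY i
    have h2 : (univ.image σ).card = s + 1 := by
      rw [card_image_of_injective _ hσ.injective]; simp
    have := card_sdiff_add_card_eq_card h1
    rwa [h2] at this
  set G : Fin (s + 1) → Finset (Finset ℕ) :=
    fun i => (powersetCard (k - 1) Z).filter fun B => insert (σ i) B ∈ F with hG
  set F₀ := (powersetCard k Z).filter fun B => B ∈ F with hF₀
  have hnot : ∀ {m : ℕ} {B : Finset ℕ} (i : Fin (s + 1)), B ∈ powersetCard m Z → σ i ∉ B :=
    fun i hB h => hσZ i ((mem_powersetCard.1 hB).1 h)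
  have hanti : Antitone G := by
    intro i j hij B hB
    rw [hG, mem_filter] at hB ⊢
    refine ⟨hB.1, ?_⟩
    rcases hij.eq_or_lt with rfl | hij
    · exact hB.2
    have hlt := hσ hij
    have := hs _ hB.2 (σ j) (mem_insert_self _ _) (σ i) (hσY i) hlt
      (by rw [mem_insert, not_or]; exact ⟨hlt.ne, hnot i hB.1⟩)
    rwa [erase_insert (hnot j hB.1)] at this
  have hdG : CrossDependent G := by
    intro g hg
    simp only [hG, mem_filter] at hg
    obtain ⟨a, b, hab, h⟩ := hd (fun i => insert (σ i) (g i)) fun i => (hg i).2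
    refine ⟨a, b, hab, fun h' => h ?_⟩
    rw [disjoint_insert_left, disjoint_insert_right, mem_insert, not_or]
    exact ⟨⟨hσ.injective.ne hab, hnot a (hg b).1⟩, hnot b (hg a).1, h'⟩
  have h1 := hdG.sum_card_add_mul_card_le hanti (fun i => filter_subset _ _)
    (by omega : (2 * s + 1) * (k - 1) ≤ Z.card)
  have h2 : F₀.card ≤ s * (G (Fin.last s)).card := by
    have hs₀ : Shifted Z F₀ := by
      intro A hA j hj i hi hij hiA
      rw [hF₀, mem_filter, mem_powersetCard] at hA ⊢
      refine ⟨⟨insert_subset hi ((erase_subset _ _).trans hA.1.1), ?_⟩,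
        hs A hA.2 j hj i (hZY hi) hij hiA⟩
      rw [card_insert_of_notMem fun h => hiA (mem_of_mem_erase h), card_erase_add_one hj, hA.1.2]
    refine (card_le_mul_card_shadow s Z k F₀ (filter_subset _ _) hs₀
      (hd.mono fun _ A hA => (mem_filter.1 hA).2)).trans
      (Nat.mul_le_mul_left _ (card_le_card fun B hB => ?_))
    obtain ⟨A, hA, x, hx, rfl⟩ := mem_shadow_iff.1 hB
    rw [hF₀, mem_filter] at hA
    have hA' := mem_powersetCard.1 hA.1
    rw [hG, mem_filter, mem_powersetCard, card_erase_of_mem hx, hA'.2]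
    have hxZ := mem_sdiff.1 (hA'.1 hx)
    exact ⟨⟨(erase_subset _ _).trans hA'.1, rfl⟩, hs A hA.2 x hx _ (hσY _)
      (hlast x hxZ.1 hxZ.2) (hnot _ hA.1)⟩
  set F₀' := (powersetCard k Z).filter fun B => B ∉ F with hF₀'
  set G' : Fin (s + 1) → Finset (Finset ℕ) :=
    fun i => (powersetCard (k - 1) Z).filter fun B => insert (σ i) B ∉ F with hG'
  set V := univ.biUnion fun i => (G' i).image (insert (σ i)) with hV
  have hVmem : ∀ {A}, A ∈ V → ∃ i, ∃ B ∈ powersetCard (k - 1) Z, A ∉ F ∧ A = insert (σ i) B := by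
    intro A hA
    obtain ⟨i, -, hA⟩ := mem_biUnion.1 hA
    obtain ⟨B, hB, rfl⟩ := mem_image.1 hA
    rw [hG', mem_filter] at hB
    exact ⟨i, B, hB.1, hB.2, rfl⟩
  have hVcard : V.card = ∑ i, (G' i).card := by
    rw [hV, card_biUnion]
    · refine sum_congr rfl fun i _ => card_image_of_injOn fun B hB C hC h => ?_
      have hB' := hnot i (mem_filter.1 hB).1
      have hC' := hnot i (mem_filter.1 hC).1
      rw [← erase_insert hB', h, erase_insert hC']
    · intro i _ j _ hij
      rw [Function.onFun, disjoint_left]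
      intro A hA hA'
      obtain ⟨B, hB, rfl⟩ := mem_image.1 hA
      obtain ⟨C, hC, hBC⟩ := mem_image.1 hA'
      have hmem : σ j ∈ insert (σ i) B := hBC ▸ mem_insert_self _ _
      rcases mem_insert.1 hmem with h | h
      · exact hij (hσ.injective h).symm
      · exact hnot j (mem_filter.1 hB).1 h
  have h3 : F.card + (F₀'.card + V.card) ≤ Y.card.choose k := by
    rw [← card_union_of_disjoint, ← card_union_of_disjoint, ← card_powersetCard]
    · refine card_le_card (union_subset hF (union_subset ?_ fun A hA => ?_))
      · exact (filter_subset _ _).trans (powersetCard_mono hZY)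
      · obtain ⟨i, B, hB, -, rfl⟩ := hVmem hA
        have hB' := mem_powersetCard.1 hB
        rw [mem_powersetCard, card_insert_of_notMem (hnot i hB), hB'.2]
        exact ⟨insert_subset (hσY i) (hB'.1.trans hZY), by omega⟩
    · rw [disjoint_left]
      intro A hA hA'
      rcases mem_union.1 hA' with h | h
      · exact (mem_filter.1 h).2 hA
      · obtain ⟨_, _, _, h, _⟩ := hVmem h
        exact h hA
    · rw [disjoint_left]
      intro A hA hA'
      obtain ⟨i, B, hB, -, rfl⟩ := hVmem hA'
      exact hnot i (mem_filter.1 hA).1 (mem_insert_self _ _)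
  have h4 : F₀.card + F₀'.card = Z.card.choose k := by
    rw [← card_powersetCard]; exact card_filter_add_card_filter_not _
  have h5 : ∑ i, (G i).card + ∑ i, (G' i).card = (s + 1) * Z.card.choose (k - 1) := by
    rw [← sum_add_distrib, sum_congr rfl (fun i _ => card_filter_add_card_filter_not _)]
    simp
  have h6 : Y.card - s = Z.card + 1 := by omega
  rw [h6, choose_succ_of_pos _ hk]
  rw [add_mul, one_mul] at h5
  omega

/-- Frankl's bound in the **Erdős matching problem**: a family of `k`-subsets of `Y` without `s + 1`
pairwise disjoint members is not larger than the family of `k`-sets meeting a fixed `s`-set. -/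
theorem erdos_matching {s k : ℕ} {Y : Finset ℕ} {F : Finset (Finset ℕ)}
    (hF : F ⊆ powersetCard k Y) (hd : CrossDependent (fun _ : Fin (s + 1) => F))
    (hY : (2 * s + 1) * k ≤ Y.card + s) :
    F.card + (Y.card - s).choose k ≤ Y.card.choose k := by
  have key := shift_induction (ι := Unit) Y (P := fun F => F () ⊆ powersetCard k Y →
    CrossDependent (fun _ : Fin (s + 1) => F ()) →
    (F ()).card + (Y.card - s).choose k ≤ Y.card.choose k)
    (fun F hs hF hd => erdos_matching_of_shifted hF (hs _) hd hY)
    (fun F i hi j _ ih hF hd => by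
      have := ih (shift_subset_powersetCard hi hF) (hd.shift i j)
      rwa [card_shift] at this)
    (fun _ => F)
  exact key hF hd

end Frankl

theorem exists_common_element_and_sunflower {n l r : ℕ} {Y : Finset ℕ} {F : Finset (Finset ℕ)}
    (hY : Y.card = n - 1) (hl : 2 ≤ l) (hlr : l < r)
    (hn : (2 * r + 1) * (l - 1) - (r - 2) ≤ n) (hF : F ⊆ powersetCard l Y)
    (hd : CrossIntersecting F F)
    (hcard : (n - 2).choose (l - 1) - (n - 2 - r).choose (l - 1) < F.card) :
    ∃ x, (∀ A ∈ F, x ∈ A) ∧ ∃ g : Fin (r + 1) → Finset ℕ, (∀ i, g i ∈ F) ∧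
      ∀ i j, i ≠ j → g i ∩ g j = {x} := by
  obtain ⟨m, rfl⟩ : ∃ m, l = m + 2 := ⟨l - 2, by omega⟩
  obtain ⟨q, rfl⟩ : ∃ q, r = m + 2 + q + 1 := ⟨r - (m + 3), by omega⟩
  set r := m + 2 + q + 1 with hr
  have hml : m + 2 - 1 = m + 1 := by omega
  rw [hml] at hn hcard
  have hexp : (2 * r + 1) * (m + 1) = 2 * r * m + m + 2 * r + 1 := by ring
  have hrm : 2 * m ≤ 2 * r * m := by nlinarith
  have hx : ∃ x, ∀ A ∈ F, x ∈ A := by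
    by_contra! hno
    have h := hilton_milner hF hd hno (by omega)
    have h1 : Y.card - 1 = n - 2 := by omega
    have h2 : n - 2 - (m + 2) = n - 2 - (m + 3) + 1 := by omega
    rw [h1, hml, h2, choose_succ_of_pos _ (by omega : 0 < m + 1)] at h
    have h3 : 0 < (n - 2 - (m + 3)).choose (m + 1 - 1) := Nat.choose_pos (by omega)
    have h4 : (n - 2 - r).choose (m + 1) ≤ (n - 2 - (m + 3)).choose (m + 1) :=
      Nat.choose_le_choose _ (by omega)
    omega
  obtain ⟨x, hx⟩ := hx
  refine ⟨x, hx, ?_⟩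
  obtain ⟨A, hA⟩ : F.Nonempty := card_pos.1 (by omega)
  have hxY : x ∈ Y := (mem_powersetCard.1 (hF hA)).1 (hx A hA)
  have hinj : Set.InjOn (fun S : Finset ℕ => S.erase x) (F : Set (Finset ℕ)) := by
    intro S hS S' hS' h
    simp only at h
    rw [← insert_erase (hx S hS), h, insert_erase (hx S' hS')]
  have hsub : F.image (fun S => S.erase x) ⊆ powersetCard (m + 1) (Y.erase x) := by
    intro S hS
    obtain ⟨R, hR, rfl⟩ := mem_image.1 hS
    have hR' := mem_powersetCard.1 (hF hR)
    rw [mem_powersetCard, card_erase_of_mem (hx R hR), hR'.2]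
    exact ⟨erase_subset_erase _ hR'.1, by omega⟩
  have hYx : (Y.erase x).card = n - 2 := by
    rw [card_erase_of_mem hxY]; omega
  have hnd : ¬ CrossDependent (fun _ : Fin (r + 1) => F.image fun S => S.erase x) := by
    intro hdep
    have h := erdos_matching hsub hdep (by omega)
    rw [card_image_of_injOn hinj, hYx] at h
    omega
  unfold CrossDependent at hnd
  push Not at hnd
  obtain ⟨g, hg, hdis⟩ := hnd
  refine ⟨fun i => insert x (g i), fun i => ?_, fun i j hij => ?_⟩
  · obtain ⟨R, hR, h⟩ := mem_image.1 (hg i)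
    simpa only [← h, insert_erase (hx R hR)] using hR
  · rw [← insert_inter_distrib, disjoint_iff_inter_eq_empty.1 (hdis i j hij), insert_empty_eq]

end ShiftedFamilies

/-- Let `2 ≤ ℓ < r` and `n ≥ (2r+1)(ℓ-1) - (r-2)`, and let `F` be an intersecting
system of `ℓ`-subsets of an `(n-1)`-set with
`|F| > C(n-2, ℓ-1) - C(n-2-r, ℓ-1)`. Then some element `x` lies in every member
of `F`, and `F` contains at least `r+1` sets pairwise intersecting exactly in `{x}`. -/
theorem stmt_18 (n ℓ r : ℕ) {α : Type*} [DecidableEq α] [Fintype α]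
    (hα : Fintype.card α = n - 1) (hℓ : 2 ≤ ℓ) (hℓr : ℓ < r)
    (hn : (2 * r + 1) * (ℓ - 1) - (r - 2) ≤ n)
    (F : Finset (Finset α)) (hF : ∀ A ∈ F, A.card = ℓ)
    (hint : ∀ A ∈ F, ∀ B ∈ F, (A ∩ B).Nonempty)
    (hcard : Nat.choose (n - 2) (ℓ - 1) - Nat.choose (n - 2 - r) (ℓ - 1) < F.card) :
    ∃ x : α, (∀ A ∈ F, x ∈ A) ∧
      ∃ G : Finset (Finset α), G ⊆ F ∧ r + 1 ≤ G.card ∧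
        ∀ A ∈ G, ∀ B ∈ G, A ≠ B → A ∩ B = {x} := by
  let f : α ↪ ℕ := (Fintype.equivFin α).toEmbedding.trans Fin.valEmbedding
  have hmem : ∀ {S : Finset ℕ}, S ∈ F.map (Finset.mapEmbedding f).toEmbedding ↔
      ∃ A ∈ F, A.map f = S := Finset.mem_map
  obtain ⟨z, hz, g, hg, hgz⟩ := ShiftedFamilies.exists_common_element_and_sunflower
    (Y := Finset.univ.map f) (F := F.map (Finset.mapEmbedding f).toEmbedding)
    (by rw [Finset.card_map, Finset.card_univ, hα]) hℓ hℓr hn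
    (fun S hS => by
      obtain ⟨A, hA, rfl⟩ := hmem.1 hS
      rw [Finset.mem_powersetCard, Finset.card_map]
      exact ⟨Finset.map_subset_map.2 (Finset.subset_univ _), hF A hA⟩)
    (fun S hS T hT => by
      obtain ⟨A, hA, rfl⟩ := hmem.1 hS
      obtain ⟨B, hB, rfl⟩ := hmem.1 hT
      rw [Finset.disjoint_map, Finset.not_disjoint_iff_nonempty_inter]
      exact hint A hA B hB)
    (by rwa [Finset.card_map])
  choose h hhF hhg using fun i => hmem.1 (hg i)
  obtain ⟨x, -, rfl⟩ := Finset.mem_map.1 ((hhg 0).symm ▸ hz _ (hg 0))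
  have hinter : ∀ i j, i ≠ j → h i ∩ h j = {x} := fun i j hij => by
    apply Finset.map_injective f
    rw [Finset.map_inter, hhg, hhg, hgz i j hij, Finset.map_singleton]
  have hinj : Function.Injective h := by
    intro i j hij
    by_contra hne
    have h1 := hinter i j hne
    rw [← hij, Finset.inter_self] at h1
    have h2 := hF _ (hhF i)
    rw [h1, Finset.card_singleton] at h2
    omega
  refine ⟨x, fun A hA => ?_, Finset.univ.image h, fun S hS => ?_, ?_, ?_⟩
  · have := hz _ (hmem.2 ⟨A, hA, rfl⟩)
    rwa [Finset.mem_map'] at this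
  · obtain ⟨i, -, rfl⟩ := Finset.mem_image.1 hS
    exact hhF i
  · rw [Finset.card_image_of_injective _ hinj]
    simp
  · intro A hA B hB hAB
    obtain ⟨i, -, rfl⟩ := Finset.mem_image.1 hA
    obtain ⟨j, -, rfl⟩ := Finset.mem_image.1 hB
    exact hinter i j fun hij => hAB (hij ▸ rfl)
end

section
/- For every integer r ≥ 1 there exists an integer N (for r > 3 one may take N = (r−2)·C(2r−2, r−2)·e^{3 r^{3/2}}·r·(r−2) + r) such that for all n ≥ N, the level B_r(n) of the weak Bruhat lattice is EKR: the maximum size of an intersecting family P ⊆ B_r(n) equals the maximum over rank-1 permutations p of |{q ∈ B_r(n) : p ≼ q}|. -/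
open Finset

theorem mem_InvSet {n : ℕ} {p : Equiv.Perm (Fin n)} {a b : Fin n} :
    (a, b) ∈ InvSet n p ↔ a < b ∧ p.symm b < p.symm a := by
  simp [InvSet]

theorem mem_ID {n : ℕ} {p : Equiv.Perm (Fin n)} {a b : Fin n} (h : (a : ℕ) + 1 = b) :
    (b : ℕ) ∈ ID n p ↔ p.symm b < p.symm a := by
  constructor
  · intro hb
    obtain ⟨-, a', b', ha', hb', hlt⟩ := mem_filter.1 hb
    obtain rfl : a' = a := Fin.ext (by omega)
    obtain rfl : b' = b := Fin.ext hb'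
    exact hlt
  · intro hlt
    exact mem_filter.2 ⟨mem_Icc.2 (by omega), a, b, h, rfl, hlt⟩

theorem exists_of_mem_ID {n i : ℕ} {p : Equiv.Perm (Fin n)} (hi : i ∈ ID n p) :
    ∃ a b : Fin n, (a : ℕ) + 1 = b ∧ (b : ℕ) = i := by
  obtain ⟨-, a, b, ha, hb, -⟩ := mem_filter.1 hi
  exact ⟨a, b, by omega, hb⟩

theorem ID_mono {n : ℕ} {p q : Equiv.Perm (Fin n)} (h : BLE p q) : ID n p ⊆ ID n q := by
  intro i hi
  obtain ⟨a, b, hab, rfl⟩ := exists_of_mem_ID hi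
  have hlt : a < b := by rw [Fin.lt_def]; omega
  rw [mem_ID hab] at hi ⊢
  exact (mem_InvSet.1 (h (mem_InvSet.2 ⟨hlt, hi⟩))).2

theorem card_ID_le_brank (n : ℕ) (p : Equiv.Perm (Fin n)) : #(ID n p) ≤ brank n p := by
  have hsub : ID n p ⊆ (InvSet n p).image (fun x => (x.2 : ℕ)) := by
    intro i hi
    obtain ⟨a, b, hab, rfl⟩ := exists_of_mem_ID hi
    rw [mem_ID hab] at hi
    refine mem_image.2 ⟨(a, b), mem_InvSet.2 ⟨?_, hi⟩, rfl⟩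
    rw [Fin.lt_def]; omega
  exact (card_le_card hsub).trans card_image_le

theorem ID_nonempty {n : ℕ} {p : Equiv.Perm (Fin n)} (hp : p ≠ 1) : (ID n p).Nonempty := by
  rw [nonempty_iff_ne_empty]
  refine fun hempty => hp ?_
  have hmono : StrictMono p.symm := by
    cases n with
    | zero => exact fun a => a.elim0
    | succ m =>
      refine Fin.strictMono_iff_lt_succ.2 fun i => ?_
      have hnot : ¬ p.symm i.succ < p.symm i.castSucc := by
        rw [← mem_ID (by simp), hempty]
        simp
      refine lt_of_le_of_ne (not_lt.1 hnot) fun he => ?_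
      exact i.castSucc_lt_succ.ne (p.symm.injective he)
  have hid : hmono.orderIsoOfSurjective _ p.symm.surjective = OrderIso.refl _ :=
    Subsingleton.elim _ _
  ext x
  have hx := DFunLike.congr_fun hid (p x)
  simp only [StrictMono.coe_orderIsoOfSurjective, OrderIso.refl_apply,
    Equiv.symm_apply_apply] at hx
  simp [← hx]

theorem brank_one_s19 (n : ℕ) : brank n 1 = 0 := by
  rw [brank, card_eq_zero, eq_empty_iff_forall_notMem]
  rintro ⟨a, b⟩ h
  obtain ⟨h₁, h₂⟩ := mem_InvSet.1 h
  exact lt_asymm h₁ h₂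

theorem ne_one_of_brank_pos_s19 {n : ℕ} {p : Equiv.Perm (Fin n)} (h : 0 < brank n p) : p ≠ 1 := by
  rintro rfl
  exact h.ne' (brank_one_s19 n)

theorem swap_lt_swap {n : ℕ} {a b x y : Fin n} (h : (a : ℕ) + 1 = b) (hxy : x < y)
    (hne : (x, y) ≠ (a, b)) :
    Equiv.swap a b x < Equiv.swap a b y ∧ (Equiv.swap a b x, Equiv.swap a b y) ≠ (a, b) := by
  simp only [Equiv.swap_apply_def, ne_eq, Prod.mk.injEq, Fin.ext_iff, Fin.lt_def] at *
  split_ifs <;> omega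

/-- Left multiplication by the adjacent transposition of a descent lowers the rank by one. -/
theorem brank_swap_mul {n : ℕ} {p : Equiv.Perm (Fin n)} {a b : Fin n} (h : (a : ℕ) + 1 = b)
    (hlt : p.symm b < p.symm a) : brank n (Equiv.swap a b * p) + 1 = brank n p := by
  have hmem : (a, b) ∈ InvSet n p := mem_InvSet.2 ⟨by rw [Fin.lt_def]; omega, hlt⟩
  have himage : InvSet n (Equiv.swap a b * p) = ((InvSet n p).erase (a, b)).map
      ((Equiv.swap a b).prodCongr (Equiv.swap a b)).toEmbedding := by
    ext ⟨x, y⟩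
    rw [mem_map_equiv]
    have hsymm (z : Fin n) : (Equiv.swap a b * p).symm z = p.symm (Equiv.swap a b z) := rfl
    simp only [Equiv.prodCongr_symm, Equiv.symm_swap, Equiv.prodCongr_apply, Prod.map_apply,
      mem_erase, mem_InvSet, hsymm]
    constructor
    · rintro ⟨hxy, hinv⟩
      have hne : (x, y) ≠ (a, b) := by
        intro he
        obtain ⟨rfl, rfl⟩ := Prod.mk.inj he
        rw [Equiv.swap_apply_left, Equiv.swap_apply_right] at hinv
        exact lt_asymm hinv hlt
      obtain ⟨h₁, h₂⟩ := swap_lt_swap h hxy hne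
      exact ⟨h₂, h₁, hinv⟩
    · rintro ⟨hne, hxy, hinv⟩
      refine ⟨?_, hinv⟩
      simpa using (swap_lt_swap h hxy hne).1
  rw [brank, himage, card_map, card_erase_add_one hmem, brank]

theorem InvSet_swap {n : ℕ} {a b : Fin n} (h : (a : ℕ) + 1 = b) :
    InvSet n (Equiv.swap a b) = {(a, b)} := by
  have hab : a < b := by rw [Fin.lt_def]; omega
  have hlt : (Equiv.swap a b).symm b < (Equiv.swap a b).symm a := by simpa using hab
  have hcard := brank_swap_mul h hlt
  rw [Equiv.swap_mul_self, brank_one_s19, zero_add] at hcard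
  obtain ⟨x, hx⟩ := card_eq_one.1 hcard.symm
  have hmem : (a, b) ∈ InvSet n (Equiv.swap a b) := mem_InvSet.2 ⟨hab, hlt⟩
  rw [hx, mem_singleton] at hmem
  rw [hx, hmem]

theorem swap_BLE_iff {n : ℕ} {p : Equiv.Perm (Fin n)} {a b : Fin n} (h : (a : ℕ) + 1 = b) :
    BLE (Equiv.swap a b) p ↔ (b : ℕ) ∈ ID n p := by
  have hab : a < b := by rw [Fin.lt_def]; omega
  rw [BLE, InvSet_swap h, singleton_subset_iff, mem_InvSet, mem_ID h]
  simp [hab]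

/-- A descent other than the one being removed survives. -/
theorem mem_ID_swap_mul {n j : ℕ} {p : Equiv.Perm (Fin n)} {a b : Fin n} (h : (a : ℕ) + 1 = b)
    (hb : (b : ℕ) ∈ ID n p) (hj : j ∈ ID n p) (hne : (b : ℕ) ≠ j) :
    j ∈ ID n (Equiv.swap a b * p) := by
  obtain ⟨c, d, hcd, rfl⟩ := exists_of_mem_ID hj
  rw [mem_ID h] at hb
  rw [mem_ID hcd] at hj ⊢
  change p.symm (Equiv.swap a b d) < p.symm (Equiv.swap a b c)
  have hdb : d ≠ b := fun he => hne (by rw [he])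
  have hca : c ≠ a := by
    rintro rfl
    omega
  by_cases hda : d = a
  · have hcb : c ≠ b := by
      rintro rfl
      subst hda
      omega
    subst hda
    rw [Equiv.swap_apply_left, Equiv.swap_apply_of_ne_of_ne hca hcb]
    exact hb.trans hj
  · rw [Equiv.swap_apply_of_ne_of_ne hda hdb]
    by_cases hcb : c = b
    · subst hcb
      rw [Equiv.swap_apply_right]
      exact hj.trans hb
    · rwa [Equiv.swap_apply_of_ne_of_ne hca hcb]

/-- The permutations of rank `r` whose inverse descent set contains `S`. -/
def levelAbove (n r : ℕ) (S : Finset ℕ) : Finset (Equiv.Perm (Fin n)) :=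
  univ.filter (fun p => brank n p = r ∧ S ⊆ ID n p)

theorem mem_levelAbove {n r : ℕ} {S : Finset ℕ} {p : Equiv.Perm (Fin n)} :
    p ∈ levelAbove n r S ↔ brank n p = r ∧ S ⊆ ID n p := by
  simp [levelAbove]

theorem card_levelAbove_insert_le (n r i : ℕ) {S : Finset ℕ} (hi : i ∉ S) :
    #(levelAbove n (r + 1) (insert i S)) ≤ #(levelAbove n r S) := by
  by_cases hex : ∃ a b : Fin n, (a : ℕ) + 1 = b ∧ (b : ℕ) = i
  · obtain ⟨a, b, hab, rfl⟩ := hex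
    refine card_le_card_of_injOn (fun p => Equiv.swap a b * p) ?_
      (mul_right_injective _).injOn
    intro p hp
    obtain ⟨hr, hsub⟩ := mem_levelAbove.1 (mem_coe.1 hp)
    have hb : (b : ℕ) ∈ ID n p := hsub (mem_insert_self _ _)
    have hrank := brank_swap_mul hab ((mem_ID hab).1 hb)
    refine mem_coe.2 (mem_levelAbove.2 ⟨Nat.add_right_cancel (hrank.trans hr), fun j hj => ?_⟩)
    refine mem_ID_swap_mul hab hb (hsub (mem_insert_of_mem hj)) ?_
    rintro rfl
    exact hi hj
  · have hempty : levelAbove n (r + 1) (insert i S) = ∅ := by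
      refine eq_empty_of_forall_notMem fun p hp => hex ?_
      exact exists_of_mem_ID ((mem_levelAbove.1 hp).2 (mem_insert_self _ _))
    simp [hempty]

theorem card_levelAbove_empty_le (n r : ℕ) : #(levelAbove n r ∅) ≤ n ^ r := by
  induction r with
  | zero =>
    rw [pow_zero, card_le_one]
    have hone : ∀ p ∈ levelAbove n 0 ∅, p = 1 := by
      intro p hp
      by_contra hne
      have hpos := (ID_nonempty hne).card_pos
      have hle := card_ID_le_brank n p
      have hzero := (mem_levelAbove.1 hp).1
      omega
    intro p hp q hq
    rw [hone p hp, hone q hq]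
  | succ r ih =>
    have hcover : levelAbove n (r + 1) ∅ ⊆
        (range n).biUnion fun i => levelAbove n (r + 1) {i} := by
      intro p hp
      have hrank := (mem_levelAbove.1 hp).1
      obtain ⟨i, hi⟩ := ID_nonempty (ne_one_of_brank_pos_s19 (p := p) (by omega))
      obtain ⟨a, b, -, rfl⟩ := exists_of_mem_ID hi
      exact mem_biUnion.2 ⟨b, mem_range.2 b.2,
        mem_levelAbove.2 ⟨hrank, singleton_subset_iff.2 hi⟩⟩
    calc #(levelAbove n (r + 1) ∅)
        ≤ #((range n).biUnion fun i => levelAbove n (r + 1) {i}) := card_le_card hcover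
      _ ≤ #(range n) * n ^ r := card_biUnion_le_card_mul _ _ _ fun i _ =>
          (card_levelAbove_insert_le n r i (notMem_empty i)).trans ih
      _ = n ^ (r + 1) := by rw [card_range, pow_succ']

theorem card_levelAbove_pair_le (n r : ℕ) {i j : ℕ} (hij : i ≠ j) :
    #(levelAbove n (r + 2) {i, j}) ≤ n ^ r :=
  (card_levelAbove_insert_le n (r + 1) i (by simpa using hij)).trans
    ((card_levelAbove_insert_le n r j (notMem_empty j)).trans (card_levelAbove_empty_le n r))

theorem exists_mem_ID_of_common_lower {n : ℕ} {p q s : Equiv.Perm (Fin n)} (hs : s ≠ 1)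
    (hp : BLE s p) (hq : BLE s q) : ∃ i ∈ ID n p, i ∈ ID n q := by
  obtain ⟨i, hi⟩ := ID_nonempty hs
  exact ⟨i, ID_mono hp hi, ID_mono hq hi⟩

/-- An intersecting family of rank `r + 2` not contained in any star has at most
`(r + 2) ^ 2 * n ^ r` members. -/
theorem card_le_of_nontrivial {n r : ℕ} {P : Finset (Equiv.Perm (Fin n))}
    (hrank : ∀ p ∈ P, brank n p = r + 2) (hP : ∀ p ∈ P, ∀ q ∈ P, ∃ i ∈ ID n p, i ∈ ID n q)
    (hstar : ∀ i, ∃ p ∈ P, i ∉ ID n p) : #P ≤ (r + 2) ^ 2 * n ^ r := by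
  choose f hfP hf using hstar
  have hcard : ∀ p ∈ P, #(ID n p) ≤ r + 2 := fun p hp =>
    (card_ID_le_brank n p).trans (hrank p hp).le
  have hcover : P ⊆ (ID n (f 0)).biUnion fun i => (ID n (f i)).biUnion fun j =>
      if i = j then ∅ else levelAbove n (r + 2) {i, j} := by
    intro q hq
    obtain ⟨i, hi, hiq⟩ := hP _ (hfP 0) q hq
    obtain ⟨j, hj, hjq⟩ := hP _ (hfP i) q hq
    refine mem_biUnion.2 ⟨i, hi, mem_biUnion.2 ⟨j, hj, ?_⟩⟩
    have hij : i ≠ j := by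
      rintro rfl
      exact hf i hj
    rw [if_neg hij, mem_levelAbove]
    refine ⟨hrank q hq, ?_⟩
    simp [insert_subset_iff, hiq, hjq]
  calc #P ≤ _ := card_le_card hcover
    _ ≤ #(ID n (f 0)) * ((r + 2) * n ^ r) := by
      refine card_biUnion_le_card_mul _ _ _ fun i _ => ?_
      refine (card_biUnion_le_card_mul _ _ (n ^ r) fun j _ => ?_).trans
        (Nat.mul_le_mul_right _ (hcard _ (hfP i)))
      split_ifs with hij
      · simp
      · exact card_levelAbove_pair_le n r hij
    _ ≤ (r + 2) * ((r + 2) * n ^ r) := Nat.mul_le_mul_right _ (hcard _ (hfP 0))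
    _ = (r + 2) ^ 2 * n ^ r := by ring

/-- The involution exchanging `2 * k` and `2 * k + 1` for each `k ∈ A`. -/
def pairSwapFun (A : Finset ℕ) (x : ℕ) : ℕ :=
  if x / 2 ∈ A then 2 * (x / 2) + (1 - x % 2) else x

theorem pairSwapFun_div_two (A : Finset ℕ) (x : ℕ) : pairSwapFun A x / 2 = x / 2 := by
  unfold pairSwapFun
  split_ifs <;> omega

theorem pairSwapFun_involutive (A : Finset ℕ) : Function.Involutive (pairSwapFun A) := by
  intro x
  have hdiv := pairSwapFun_div_two A x
  rw [pairSwapFun, hdiv]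
  unfold pairSwapFun
  split_ifs <;> omega

theorem pairSwapFun_lt {A : Finset ℕ} {m n x : ℕ} (hA : A ⊆ range m) (hm : 2 * m ≤ n)
    (hx : x < n) : pairSwapFun A x < n := by
  unfold pairSwapFun
  split_ifs with h
  · have := mem_range.1 (hA h)
    omega
  · exact hx

/-- The product of the commuting transpositions of `2 * k` and `2 * k + 1` for `k ∈ A`. -/
def pairSwap {A : Finset ℕ} {m n : ℕ} (hA : A ⊆ range m) (hm : 2 * m ≤ n) :
    Equiv.Perm (Fin n) :=
  Function.Involutive.toPerm (fun x => ⟨pairSwapFun A x, pairSwapFun_lt hA hm x.2⟩)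
    fun x => Fin.ext (pairSwapFun_involutive A x)

theorem coe_pairSwap_symm {A : Finset ℕ} {m n : ℕ} (hA : A ⊆ range m) (hm : 2 * m ≤ n)
    (x : Fin n) : ((pairSwap hA hm).symm x : ℕ) = pairSwapFun A x := rfl

theorem mem_InvSet_pairSwap {A : Finset ℕ} {m n : ℕ} (hA : A ⊆ range m) (hm : 2 * m ≤ n)
    {a b : Fin n} : (a, b) ∈ InvSet n (pairSwap hA hm) ↔
      (a : ℕ) / 2 ∈ A ∧ (a : ℕ) % 2 = 0 ∧ (b : ℕ) = a + 1 := by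
  rw [mem_InvSet, Fin.lt_def, Fin.lt_def, coe_pairSwap_symm, coe_pairSwap_symm]
  have ha := pairSwapFun_div_two A a
  have hb := pairSwapFun_div_two A b
  constructor
  · rintro ⟨h₁, h₂⟩
    have hab : (b : ℕ) / 2 = a / 2 := by omega
    have hmem : (a : ℕ) / 2 ∈ A := by
      by_contra hnot
      rw [pairSwapFun, pairSwapFun, hab, if_neg hnot, if_neg hnot] at h₂
      omega
    exact ⟨hmem, by omega, by omega⟩
  · rintro ⟨hmem, h₁, h₂⟩
    have hab : (b : ℕ) / 2 = a / 2 := by omega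
    rw [pairSwapFun, pairSwapFun, hab, if_pos hmem, if_pos hmem]
    omega

theorem brank_pairSwap {A : Finset ℕ} {m n : ℕ} (hA : A ⊆ range m) (hm : 2 * m ≤ n) :
    brank n (pairSwap hA hm) = #A := by
  refine card_bij (fun x _ => (x.1 : ℕ) / 2) ?_ ?_ ?_
  · rintro ⟨a, b⟩ h
    exact ((mem_InvSet_pairSwap hA hm).1 h).1
  · rintro ⟨a, b⟩ h ⟨c, d⟩ h' he
    rw [mem_InvSet_pairSwap] at h h'
    simp only [Prod.mk.injEq, Fin.ext_iff] at he ⊢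
    omega
  · intro k hk
    have hkm := mem_range.1 (hA hk)
    refine ⟨(⟨2 * k, by omega⟩, ⟨2 * k + 1, by omega⟩), ?_, ?_⟩
    · rw [mem_InvSet_pairSwap]
      simp [hk]
    · simp

theorem mem_ID_pairSwap {A : Finset ℕ} {m n k : ℕ} (hA : A ⊆ range m) (hm : 2 * m ≤ n)
    (hk : k < m) : 2 * k + 1 ∈ ID n (pairSwap hA hm) ↔ k ∈ A := by
  have h : ((⟨2 * k, by omega⟩ : Fin n) : ℕ) + 1 = (⟨2 * k + 1, by omega⟩ : Fin n) := rfl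
  have hlt : (⟨2 * k, by omega⟩ : Fin n) < ⟨2 * k + 1, by omega⟩ := by simp
  have hmem := mem_InvSet_pairSwap hA hm (a := ⟨2 * k, by omega⟩) (b := ⟨2 * k + 1, by omega⟩)
  rw [mem_InvSet] at hmem
  refine (mem_ID h).trans ?_
  simpa [hlt] using hmem

theorem choose_le_card_levelAbove {m n : ℕ} (r : ℕ) (hm : 2 * (m + 1) ≤ n) :
    m.choose r ≤ #(levelAbove n (r + 1) {1}) := by
  have hsub (A : Finset ℕ) (hA : A ∈ powersetCard r (Ico 1 (m + 1))) :
      insert 0 A ⊆ range (m + 1) := by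
    intro k hk
    rcases mem_insert.1 hk with rfl | hk
    · simp
    · have := mem_Ico.1 ((mem_powersetCard.1 hA).1 hk)
      exact mem_range.2 this.2
  have hzero (A : Finset ℕ) (hA : A ∈ powersetCard r (Ico 1 (m + 1))) : 0 ∉ A := by
    intro h
    have := mem_Ico.1 ((mem_powersetCard.1 hA).1 h)
    omega
  have hcard : #(powersetCard r (Ico 1 (m + 1))) = m.choose r := by simp
  rw [← hcard, ← card_attach]
  refine card_le_card_of_injOn (fun A => pairSwap (hsub A.1 A.2) hm) ?_ ?_
  · rintro ⟨A, hA⟩ -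
    refine mem_coe.2 (mem_levelAbove.2 ⟨?_, singleton_subset_iff.2 ?_⟩)
    · rw [brank_pairSwap, card_insert_of_notMem (hzero A hA), (mem_powersetCard.1 hA).2]
    · exact (mem_ID_pairSwap (k := 0) (hsub A hA) hm (by omega)).2 (mem_insert_self _ _)
  · rintro ⟨A, hA⟩ - ⟨B, hB⟩ - he
    have hins : insert 0 A = insert 0 B := by
      ext k
      by_cases hk : k < m + 1
      · rw [← mem_ID_pairSwap (hsub A hA) hm hk, ← mem_ID_pairSwap (hsub B hB) hm hk]
        exact iff_of_eq (congrArg (fun p => 2 * k + 1 ∈ ID n p) he)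
      · exact iff_of_false (fun h => hk (mem_range.1 (hsub A hA h)))
          (fun h => hk (mem_range.1 (hsub B hB h)))
    have hAB := congrArg (fun C => C.erase 0) hins
    simp only [erase_insert (hzero A hA), erase_insert (hzero B hB)] at hAB
    exact Subtype.ext hAB

theorem sq_mul_pow_le_choose {m n r : ℕ} (hmn : n ≤ 2 * m + 3)
    (hn : 6 ^ (r + 1) * (r + 1).factorial * (r + 2) ^ 2 + 6 * r + 12 ≤ n) :
    (r + 2) ^ 2 * n ^ r ≤ m.choose (r + 1) := by
  have hpow : (m + 1 - (r + 1)) ^ (r + 1) ≤ (r + 1).factorial * m.choose (r + 1) := by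
    rw [← Nat.descFactorial_eq_factorial_mul_choose]
    exact Nat.pow_sub_le_descFactorial m (r + 1)
  have hlin : n ≤ 6 * (m + 1 - (r + 1)) := by omega
  have hpos : 0 < 6 ^ (r + 1) * (r + 1).factorial := by positivity
  refine Nat.le_of_mul_le_mul_left ?_ hpos
  calc 6 ^ (r + 1) * (r + 1).factorial * ((r + 2) ^ 2 * n ^ r)
      = (6 ^ (r + 1) * (r + 1).factorial * (r + 2) ^ 2) * n ^ r := by ring
    _ ≤ n * n ^ r := Nat.mul_le_mul_right _ (by omega)
    _ = n ^ (r + 1) := (pow_succ' n r).symm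
    _ ≤ (6 * (m + 1 - (r + 1))) ^ (r + 1) := Nat.pow_le_pow_left hlin _
    _ = 6 ^ (r + 1) * (m + 1 - (r + 1)) ^ (r + 1) := mul_pow _ _ _
    _ ≤ 6 ^ (r + 1) * ((r + 1).factorial * m.choose (r + 1)) := Nat.mul_le_mul_left _ hpow
    _ = 6 ^ (r + 1) * (r + 1).factorial * m.choose (r + 1) := by ring

theorem exists_star_card_le {n r : ℕ} {P : Finset (Equiv.Perm (Fin n))}
    (hn : 6 ^ r * r.factorial * (r + 1) ^ 2 + 6 * r + 12 ≤ n)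
    (hrank : ∀ p ∈ P, brank n p = r + 1)
    (hP : ∀ p ∈ P, ∀ q ∈ P, ∃ i ∈ ID n p, i ∈ ID n q) :
    ∃ a b : Fin n, (a : ℕ) + 1 = b ∧ #P ≤ #(levelAbove n (r + 1) {(b : ℕ)}) := by
  rcases P.eq_empty_or_nonempty with rfl | ⟨p, hp⟩
  · exact ⟨⟨0, by omega⟩, ⟨1, by omega⟩, rfl, by simp⟩
  by_cases hstar : ∃ i, ∀ q ∈ P, i ∈ ID n q
  · obtain ⟨i, hi⟩ := hstar
    obtain ⟨a, b, hab, rfl⟩ := exists_of_mem_ID (hi p hp)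
    exact ⟨a, b, hab, card_le_card fun q hq =>
      mem_levelAbove.2 ⟨hrank q hq, singleton_subset_iff.2 (hi q hq)⟩⟩
  · cases r with
    | zero =>
      obtain ⟨i, hi, -⟩ := hP p hp p hp
      refine absurd ⟨i, fun q hq => ?_⟩ hstar
      obtain ⟨j, hj, hjq⟩ := hP p hp q hq
      have hle := (card_ID_le_brank n p).trans (hrank p hp).le
      rwa [card_le_one.1 hle i hi j hj]
    | succ r =>
      push Not at hstar
      refine ⟨⟨0, by omega⟩, ⟨1, by omega⟩, rfl, ?_⟩
      calc #P ≤ (r + 2) ^ 2 * n ^ r := card_le_of_nontrivial hrank hP hstar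
        _ ≤ (n / 2 - 1).choose (r + 1) :=
          sq_mul_pow_le_choose (by omega) (le_trans (by gcongr; omega) hn)
        _ ≤ _ := choose_le_card_levelAbove (r + 1) (by omega)

/-- For every `r ≥ 1` there is an `N` such that for all `n ≥ N` the level `B_r(n)` is
EKR: every intersecting family of rank-`r` permutations is no larger than the star
`{q ∈ B_r(n) : p₀ ≼ q}` of some rank-1 permutation `p₀`, and every such star is itself
an intersecting family. -/
theorem stmt_19 (r : ℕ) (hr : 1 ≤ r) :
    ∃ N : ℕ, ∀ n : ℕ, N ≤ n →
      (∀ P : Set (Equiv.Perm (Fin n)), (∀ p ∈ P, brank n p = r) → BInter n P →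
        ∃ p₀ : Equiv.Perm (Fin n), brank n p₀ = 1 ∧
          Nat.card P ≤ Nat.card {q : Equiv.Perm (Fin n) | brank n q = r ∧ BLE p₀ q}) ∧
      (∀ p₀ : Equiv.Perm (Fin n), brank n p₀ = 1 →
        BInter n {q | brank n q = r ∧ BLE p₀ q}) := by
  obtain ⟨r, rfl⟩ : ∃ k, r = k + 1 := ⟨r - 1, by omega⟩
  refine ⟨6 ^ r * r.factorial * (r + 1) ^ 2 + 6 * r + 12, fun n hn => ⟨?_, ?_⟩⟩
  · intro P hrank hP
    classical
    have hinter : ∀ p ∈ P.toFinset, ∀ q ∈ P.toFinset, ∃ i ∈ ID n p, i ∈ ID n q := by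
      intro p hp q hq
      obtain ⟨s, hs, hsp, hsq⟩ := hP p (Set.mem_toFinset.1 hp) q (Set.mem_toFinset.1 hq)
      exact exists_mem_ID_of_common_lower hs hsp hsq
    obtain ⟨a, b, hab, hle⟩ := exists_star_card_le hn
      (fun p hp => hrank p (Set.mem_toFinset.1 hp)) hinter
    refine ⟨Equiv.swap a b, by rw [brank, InvSet_swap hab, card_singleton], ?_⟩
    have hstar : {q : Equiv.Perm (Fin n) | brank n q = r + 1 ∧ BLE (Equiv.swap a b) q} =
        (levelAbove n (r + 1) {(b : ℕ)} : Set (Equiv.Perm (Fin n))) := by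
      ext q
      simp only [Set.mem_ofPred_eq, mem_coe, mem_levelAbove, swap_BLE_iff hab,
        singleton_subset_iff]
    rw [hstar, Nat.card_coe_set_eq, Nat.card_coe_set_eq, Set.ncard_coe_finset,
      Set.ncard_eq_toFinset_card']
    exact hle
  · intro p₀ hp₀ p hp q hq
    exact ⟨p₀, ne_one_of_brank_pos_s19 (by omega), hp.2, hq.2⟩
end
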